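/- Let k ≤ m ≤ n and 0 < l ≤ m with k > m − l > 0. For positive reals r_1,…,r_m and c_1,…,c_n, the limit of E(k,r_1,…,r_m,c) − E(k+l−m, r_1,…,r_l, c) as r_1,…,r_l all tend to 0 from above equals ∑_K Pr(c,K)·E(m−l, r_{l+1},…,r_m, c'(K)), where the sum is over subsets K ⊆ {1,…,n} with |K| = k+l−m and c'(K) denotes the tuple of c_j's with j ∉ K. -/

import Mathlib

open MeasureTheory Filter

/-- A `k`-assignment of an `m × n` matrix: a set of `k` positions,
no two in the same row or column. -/
def IsAssignF (m n k : ℕ) (S : Finset (Fin m × Fin n)) : Prop :=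
  S.card = k ∧ ∀ p ∈ S, ∀ q ∈ S, p ≠ q → p.1 ≠ q.1 ∧ p.2 ≠ q.2

/-- The value `min_k(x)` of a minimum `k`-assignment of the matrix `x`. -/
noncomputable def minAssign (m n k : ℕ) (x : Fin m × Fin n → ℝ) : ℝ :=
  sInf {v | ∃ S : Finset (Fin m × Fin n), IsAssignF m n k S ∧ v = ∑ p ∈ S, x p}

/-- The law of a random exponential `m × n` matrix whose entry `(i,j)` has rate
`r i * c j` (rates indexed by naturals, rows `0,…,m−1` and columns `0,…,n−1`):
the measure on `(Fin m × Fin n) → ℝ` with the product exponential density with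
respect to Lebesgue measure. -/
noncomputable def rankOneMeasure (m n : ℕ) (r c : ℕ → ℝ) :
    Measure ((Fin m × Fin n) → ℝ) :=
  volume.withDensity fun x => ENNReal.ofReal
    (∏ p : Fin m × Fin n,
      if 0 ≤ x p then (r p.1.val * c p.2.val) * Real.exp (-((r p.1.val * c p.2.val) * x p))
      else 0)

/-- `E(k, r₀…r_{m−1}, c₀…c_{n−1})`: the expected value of the minimum `k`-assignment of a
random exponential `m × n` matrix with rank 1 rate matrix `(r i * c j)`. -/
noncomputable def Emin (k m n : ℕ) (r c : ℕ → ℝ) : ℝ :=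
  ∫ x, minAssign m n k x ∂(rankOneMeasure m n r c)

/-- The urn probability of drawing the balls of the list `L` first, in the order of `L`,
when the total weight is `C`: `∏_s c_{j_s} / (C − ∑_{u<s} c_{j_u})`. -/
noncomputable def prList (c : ℕ → ℝ) : ℝ → List ℕ → ℝ
  | _, [] => 1
  | C, j :: L => c j / C * prList c (C - c j) L

/-- `Pr(c, K)` for a set `K` of columns of an `n`-column matrix: the sum over all
orderings of `K` of the urn probabilities. -/
noncomputable def prSetN (c : ℕ → ℝ) (n : ℕ) (K : Finset ℕ) : ℝ :=
  (K.toList.permutations.map (prList c (∑ j ∈ Finset.range n, c j))).sum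

set_option linter.unusedSectionVars false

section Matchings

variable {ι κ : Type*}

/-- A set of positions, no two in the same row or column. -/
def IsMatching (S : Finset (ι × κ)) : Prop :=
  ∀ p ∈ S, ∀ q ∈ S, p ≠ q → p.1 ≠ q.1 ∧ p.2 ≠ q.2

theorem IsMatching.mono {S T : Finset (ι × κ)} (hS : IsMatching S) (h : T ⊆ S) :
    IsMatching T := fun p hp q hq => hS p (h hp) q (h hq)

theorem IsMatching.eq_of_fst {S : Finset (ι × κ)} (hS : IsMatching S) {p q : ι × κ}
    (hp : p ∈ S) (hq : q ∈ S) (h : p.1 = q.1) : p = q := by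
  by_contra hne
  exact (hS p hp q hq hne).1 h

theorem IsMatching.eq_of_snd {S : Finset (ι × κ)} (hS : IsMatching S) {p q : ι × κ}
    (hp : p ∈ S) (hq : q ∈ S) (h : p.2 = q.2) : p = q := by
  by_contra hne
  exact (hS p hp q hq hne).2 h

theorem IsMatching.injOn_snd {S : Finset (ι × κ)} (hS : IsMatching S) :
    Set.InjOn Prod.snd (S : Set (ι × κ)) :=
  fun _ hp _ hq h => hS.eq_of_snd hp hq h

theorem IsMatching.injOn_fst {S : Finset (ι × κ)} (hS : IsMatching S) :
    Set.InjOn Prod.fst (S : Set (ι × κ)) :=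
  fun _ hp _ hq h => hS.eq_of_fst hp hq h

variable [DecidableEq ι] [DecidableEq κ]

/-- The set of columns used by a set of positions. -/
def cols (S : Finset (ι × κ)) : Finset κ := S.image Prod.snd

/-- The set of rows used by a set of positions. -/
def rows (S : Finset (ι × κ)) : Finset ι := S.image Prod.fst

theorem mem_cols {S : Finset (ι × κ)} {j : κ} : j ∈ cols S ↔ ∃ i, (i, j) ∈ S := by
  simp [cols]

theorem mem_rows {S : Finset (ι × κ)} {i : ι} : i ∈ rows S ↔ ∃ j, (i, j) ∈ S := by
  simp [rows]

theorem cols_mono {S T : Finset (ι × κ)} (h : S ⊆ T) : cols S ⊆ cols T :=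
  Finset.image_subset_image h

theorem rows_mono {S T : Finset (ι × κ)} (h : S ⊆ T) : rows S ⊆ rows T :=
  Finset.image_subset_image h

theorem cols_insert (p : ι × κ) (S : Finset (ι × κ)) :
    cols (insert p S) = insert p.2 (cols S) := Finset.image_insert _ _ _

theorem rows_insert (p : ι × κ) (S : Finset (ι × κ)) :
    rows (insert p S) = insert p.1 (rows S) := Finset.image_insert _ _ _

theorem IsMatching.card_cols {S : Finset (ι × κ)} (hS : IsMatching S) :
    (cols S).card = S.card := Finset.card_image_of_injOn hS.injOn_snd

theorem IsMatching.card_rows {S : Finset (ι × κ)} (hS : IsMatching S) :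
    (rows S).card = S.card := Finset.card_image_of_injOn hS.injOn_fst

theorem IsMatching.insert_pair {S : Finset (ι × κ)} (hS : IsMatching S) {i : ι} {j : κ}
    (hi : i ∉ rows S) (hj : j ∉ cols S) : IsMatching (insert (i, j) S) := by
  intro p hp q hq hne
  have key : ∀ p ∈ S, p.1 ≠ i ∧ p.2 ≠ j := fun p hp =>
    ⟨fun h => hi (h ▸ Finset.mem_image_of_mem _ hp), fun h => hj (h ▸ Finset.mem_image_of_mem _ hp)⟩
  rcases Finset.mem_insert.1 hp with rfl | hp <;> rcases Finset.mem_insert.1 hq with rfl | hq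
  · exact absurd rfl hne
  · exact ⟨(key q hq).1.symm, (key q hq).2.symm⟩
  · exact key p hp
  · exact hS p hp q hq hne

theorem IsMatching.cols_erase {S : Finset (ι × κ)} (hS : IsMatching S) {i : ι} {j : κ}
    (h : (i, j) ∈ S) : cols (S.erase (i, j)) = (cols S).erase j := by
  ext a
  simp only [mem_cols, Finset.mem_erase]
  constructor
  · rintro ⟨b, hne, hb⟩
    refine ⟨?_, b, hb⟩
    rintro rfl
    exact hne (hS.eq_of_snd hb h rfl)
  · rintro ⟨hne, b, hb⟩
    exact ⟨b, fun h => hne (congrArg Prod.snd h), hb⟩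

theorem IsMatching.rows_erase {S : Finset (ι × κ)} (hS : IsMatching S) {i : ι} {j : κ}
    (h : (i, j) ∈ S) : rows (S.erase (i, j)) = (rows S).erase i := by
  ext a
  simp only [mem_rows, Finset.mem_erase]
  constructor
  · rintro ⟨b, hne, hb⟩
    refine ⟨?_, b, hb⟩
    rintro rfl
    exact hne (hS.eq_of_fst hb h rfl)
  · rintro ⟨hne, b, hb⟩
    exact ⟨b, fun h => hne (congrArg Prod.fst h), hb⟩

theorem notMem_of_notMem_cols {S : Finset (ι × κ)} {i : ι} {j : κ} (h : j ∉ cols S) :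
    (i, j) ∉ S := fun hm => h (mem_cols.2 ⟨i, hm⟩)

/-- The exchange property of matchings: a column used by `M'` but not by `M` can be moved
from `M'` to `M` along an alternating path, preserving the total weight. -/
theorem IsMatching.exchange (x : ι × κ → ℝ) (M : Finset (ι × κ)) :
    ∀ (M' : Finset (ι × κ)), IsMatching M → IsMatching M' → ∀ j ∈ cols M', j ∉ cols M →
    ∃ T T' : Finset (ι × κ), IsMatching T ∧ IsMatching T' ∧
      ∑ p ∈ T, x p + ∑ p ∈ T', x p = ∑ p ∈ M, x p + ∑ p ∈ M', x p ∧
      rows T ⊆ rows M ∪ rows M' ∧ rows T' ⊆ rows M ∪ rows M' ∧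
      ((cols T = insert j (cols M) ∧ cols T' = (cols M').erase j) ∨
        ∃ a ∈ cols M, a ∉ cols M' ∧ cols T = insert j ((cols M).erase a) ∧
          cols T' = insert a ((cols M').erase j)) := by
  induction M using Finset.strongInduction with
  | H M ih =>
  intro M' hM hM' j hj' hj
  obtain ⟨i, hij⟩ := mem_cols.1 hj'
  have hijM : (i, j) ∉ M := notMem_of_notMem_cols hj
  have sum_erase' : ∑ p ∈ M'.erase (i, j), x p + x (i, j) = ∑ p ∈ M', x p :=
    Finset.sum_erase_add _ _ hij
  have hi' : i ∈ rows M' := mem_rows.2 ⟨j, hij⟩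
  by_cases hi : i ∈ rows M
  swap
  · refine ⟨insert (i, j) M, M'.erase (i, j), hM.insert_pair hi hj,
      hM'.mono (Finset.erase_subset _ _), ?_, ?_, ?_, Or.inl ⟨cols_insert _ _, hM'.cols_erase hij⟩⟩
    · rw [Finset.sum_insert hijM]; linarith
    · rw [rows_insert]
      exact Finset.insert_subset (Finset.mem_union_right _ hi') Finset.subset_union_left
    · exact (rows_mono (Finset.erase_subset _ _)).trans Finset.subset_union_right
  obtain ⟨a, hia⟩ := mem_rows.1 hi
  have haM : a ∈ cols M := mem_cols.2 ⟨i, hia⟩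
  have haj : a ≠ j := by rintro rfl; exact hj haM
  have sum_erase : ∑ p ∈ M.erase (i, a), x p + x (i, a) = ∑ p ∈ M, x p :=
    Finset.sum_erase_add _ _ hia
  have hc := hM.cols_erase hia
  have hr := hM.rows_erase hia
  have hc' := hM'.cols_erase hij
  have hr' := hM'.rows_erase hij
  have h1 : IsMatching (M.erase (i, a)) := hM.mono (Finset.erase_subset _ _)
  have h1' : IsMatching (M'.erase (i, j)) := hM'.mono (Finset.erase_subset _ _)
  by_cases ha : a ∈ cols M'
  swap
  · have hj1 : j ∉ cols (M.erase (i, a)) := by rw [hc]; simp [hj]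
    have ha1 : a ∉ cols (M'.erase (i, j)) := by rw [hc']; simp [ha]
    refine ⟨insert (i, j) (M.erase (i, a)), insert (i, a) (M'.erase (i, j)),
      h1.insert_pair (by rw [hr]; simp) hj1, h1'.insert_pair (by rw [hr']; simp) ha1, ?_, ?_, ?_,
      Or.inr ⟨a, haM, ha, by rw [cols_insert, hc], by rw [cols_insert, hc']⟩⟩
    · rw [Finset.sum_insert (notMem_of_notMem_cols hj1),
        Finset.sum_insert (notMem_of_notMem_cols ha1)]
      linarith
    · rw [rows_insert, hr, Finset.insert_erase hi]; exact Finset.subset_union_left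
    · rw [rows_insert, hr', Finset.insert_erase hi']; exact Finset.subset_union_right
  obtain ⟨T, T', hT, hT', hsum, hrT, hrT', hcases⟩ :=
    ih _ (Finset.erase_ssubset hia) (M'.erase (i, j)) h1 h1' a
      (by rw [hc']; simp [ha, haj]) (by rw [hc]; simp)
  have hiT : i ∉ rows T := fun h => by
    have := hrT h
    rw [hr, hr'] at this
    simp at this
  have hiT' : i ∉ rows T' := fun h => by
    have := hrT' h
    rw [hr, hr'] at this
    simp at this
  have hsub : rows (M.erase (i, a)) ∪ rows (M'.erase (i, j)) ⊆ rows M ∪ rows M' :=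
    Finset.union_subset_union (rows_mono (Finset.erase_subset _ _))
      (rows_mono (Finset.erase_subset _ _))
  rw [hc, hc'] at hcases
  have hjT : j ∉ cols T := by
    rcases hcases with ⟨h, -⟩ | ⟨b, -, -, h, -⟩ <;> rw [h] <;> simp [hj, haj.symm]
  have haT' : a ∉ cols T' := by
    rcases hcases with ⟨-, h⟩ | ⟨b, hb, -, -, h⟩
    · rw [h]; simp
    · have := (Finset.mem_erase.1 hb).1.symm
      rw [h]; simp [this]
  refine ⟨insert (i, j) T, insert (i, a) T', hT.insert_pair hiT hjT, hT'.insert_pair hiT' haT', ?_, ?_, ?_, ?_⟩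
  · rw [Finset.sum_insert (notMem_of_notMem_cols hjT),
      Finset.sum_insert (notMem_of_notMem_cols haT')]
    linarith
  · rw [rows_insert]
    exact Finset.insert_subset (Finset.mem_union_right _ hi') (hrT.trans hsub)
  · rw [rows_insert]
    exact Finset.insert_subset (Finset.mem_union_right _ hi') (hrT'.trans hsub)
  · rw [cols_insert, cols_insert]
    rcases hcases with ⟨h, h'⟩ | ⟨b, hb, hb', h, h'⟩
    · left
      rw [h, h']
      refine ⟨by rw [Finset.insert_erase haM], ?_⟩
      exact Finset.insert_erase (Finset.mem_erase.2 ⟨haj, ha⟩)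
    · right
      obtain ⟨hba, hbM⟩ := Finset.mem_erase.1 hb
      have hbj : b ≠ j := by rintro rfl; exact hj hbM
      have hbM' : b ∉ cols M' := fun hh => hb' (Finset.mem_erase.2 ⟨hbj, hh⟩)
      refine ⟨b, hbM, hbM', ?_, ?_⟩
      · rw [h]
        ext z
        simp only [Finset.mem_insert, Finset.mem_erase]
        grind
      · rw [h']
        ext z
        simp only [Finset.mem_insert, Finset.mem_erase]
        grind

/-- `S` is the strictly best matching of size `t` among those with at most one column
outside `K`. -/
def IsBest (x : ι × κ → ℝ) (K : Finset κ) (t : ℕ) (S : Finset (ι × κ)) : Prop :=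
  (IsMatching S ∧ S.card = t ∧ (cols S \ K).card ≤ 1) ∧
    ∀ S', IsMatching S' → S'.card = t → (cols S' \ K).card ≤ 1 → S' ≠ S →
      ∑ p ∈ S, x p < ∑ p ∈ S', x p

theorem IsBest.unique {x : ι × κ → ℝ} {K : Finset κ} {t : ℕ} {S S' : Finset (ι × κ)}
    (h : IsBest x K t S) (h' : IsBest x K t S') : S = S' := by
  by_contra hne
  have h1 := h.2 S' h'.1.1 h'.1.2.1 h'.1.2.2 (Ne.symm hne)
  have h2 := h'.2 S h.1.1 h.1.2.1 h.1.2.2 hne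
  linarith

theorem IsBest.of_class {x : ι × κ → ℝ} {K L : Finset κ} {t : ℕ} {S : Finset (ι × κ)}
    (h : IsBest x L t S) (hKL : K ⊆ L) (hS : (cols S \ K).card ≤ 1) : IsBest x K t S :=
  ⟨⟨h.1.1, h.1.2.1, hS⟩, fun S' h1 h2 h3 h4 => h.2 S' h1 h2
    ((Finset.card_le_card (Finset.sdiff_subset_sdiff subset_rfl hKL)).trans h3) h4⟩

/-- Distinct sets of positions have distinct weights. -/
def SumsDistinct (x : ι × κ → ℝ) : Prop :=
  ∀ S S' : Finset (ι × κ), ∑ p ∈ S, x p = ∑ p ∈ S', x p → S = S'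

variable [Fintype ι] [Fintype κ]

theorem SumsDistinct.exists_isBest {x : ι × κ → ℝ} (hx : SumsDistinct x) {K : Finset κ} {t : ℕ}
    (hne : ∃ S : Finset (ι × κ), IsMatching S ∧ S.card = t ∧ (cols S \ K).card ≤ 1) :
    ∃ S, IsBest x K t S := by
  classical
  obtain ⟨S, hS, hmin⟩ := Finset.exists_min_image
    (Finset.univ.filter fun S : Finset (ι × κ) =>
      IsMatching S ∧ S.card = t ∧ (cols S \ K).card ≤ 1) (fun S => ∑ p ∈ S, x p)
    (by obtain ⟨S, hS⟩ := hne; exact ⟨S, by simpa using hS⟩)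
  refine ⟨S, by simpa using hS, fun S' h1 h2 h3 h4 => lt_of_le_of_ne (hmin S' (by simp [h1, h2, h3]))
    fun h => h4 (hx _ _ h).symm⟩

/-- The columns of consecutive best matchings are nested. -/
theorem IsBest.nested {x : ι × κ → ℝ} {K : Finset κ} {s : ℕ} {S S' : Finset (ι × κ)}
    (h : IsBest x K s S) (h' : IsBest x K (s + 1) S') (hK : cols S' ⊆ K) :
    ∃ j ∉ cols S, cols S' = insert j (cols S) := by
  have hlt : (cols S).card < (cols S').card := by
    rw [h.1.1.card_cols, h'.1.1.card_cols, h.1.2.1, h'.1.2.1]; exact s.lt_succ_self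
  obtain ⟨j, hj', hj⟩ := Finset.exists_mem_notMem_of_card_lt_card hlt
  refine ⟨j, hj, ?_⟩
  obtain ⟨T, T', hT, hT', hsum, -, -, hcases⟩ := IsMatching.exchange x S S' h.1.1 h'.1.1 j hj' hj
  have hcS := h.1.1.card_cols
  have hcS' := h'.1.1.card_cols
  have hcT := hT.card_cols
  have hcT' := hT'.card_cols
  rw [h.1.2.1] at hcS
  rw [h'.1.2.1] at hcS'
  rcases hcases with ⟨e, e'⟩ | ⟨a, ha, ha', e, e'⟩
  · rw [e, Finset.card_insert_of_notMem hj, hcS] at hcT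
    rw [e', Finset.card_erase_of_mem hj', hcS'] at hcT'
    have hclT : (cols T \ K).card ≤ 1 := by
      rw [e, Finset.insert_sdiff_of_mem _ (hK hj')]; exact h.1.2.2
    have hclT' : (cols T' \ K).card ≤ 1 := by
      have : cols T' \ K = ∅ := by
        rw [Finset.sdiff_eq_empty_iff_subset, e']; exact (Finset.erase_subset _ _).trans hK
      simp [this]
    by_cases hTS : T = S'
    · rw [← hTS, e]
    · have h1 := h'.2 T hT hcT.symm hclT hTS
      have h2 : ∑ p ∈ S, x p ≤ ∑ p ∈ T', x p := by
        by_cases hTS' : T' = S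
        · rw [hTS']
        · exact (h.2 T' hT' (by omega) hclT' hTS').le
      linarith
  · exfalso
    have hja : j ≠ a := by rintro rfl; exact hj ha
    rw [e, Finset.card_insert_of_notMem (by simp [hj]), Finset.card_erase_of_mem ha, hcS] at hcT
    rw [e', Finset.card_insert_of_notMem (by simp [ha']), Finset.card_erase_of_mem hj', hcS'] at hcT'
    have hpos : 0 < s := by rw [← hcS]; exact Finset.card_pos.2 ⟨a, ha⟩
    have hclT : (cols T \ K).card ≤ 1 := by
      rw [e, Finset.insert_sdiff_of_mem _ (hK hj')]
      exact (Finset.card_le_card (Finset.sdiff_subset_sdiff (Finset.erase_subset _ _)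
        subset_rfl)).trans h.1.2.2
    have hclT' : (cols T' \ K).card ≤ 1 := by
      have : cols T' \ K ⊆ {a} := by
        rw [e']
        intro z hz
        simp only [Finset.mem_sdiff, Finset.mem_insert, Finset.mem_erase] at hz
        rcases hz with ⟨rfl | hz, hzK⟩
        · simp
        · exact absurd (hK hz.2) hzK
      exact (Finset.card_le_card this).trans (by simp)
    have h1 := h.2 T hT (by omega) hclT
      (by intro hh; exact hj (hh ▸ e ▸ Finset.mem_insert_self _ _))
    have h2 := h'.2 T' hT' (by omega) hclT'
      (by intro hh; exact ha' (hh ▸ e' ▸ Finset.mem_insert_self _ _))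
    linarith

theorem card_cols_sdiff_univ_le (S : Finset (ι × κ)) :
    (cols S \ Finset.univ).card ≤ 1 := by
  rw [Finset.sdiff_eq_empty_iff_subset.2 (Finset.subset_univ _)]; simp

theorem exists_isMatching_card {t : ℕ} (h1 : t ≤ Fintype.card ι) (h2 : t ≤ Fintype.card κ) :
    ∃ S : Finset (ι × κ), IsMatching S ∧ S.card = t := by
  obtain ⟨e⟩ : Nonempty (Fin t ↪ ι) := by
    rw [Function.Embedding.nonempty_iff_card_le]; simpa using h1
  obtain ⟨f⟩ : Nonempty (Fin t ↪ κ) := by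
    rw [Function.Embedding.nonempty_iff_card_le]; simpa using h2
  refine ⟨Finset.univ.map ⟨fun a => (e a, f a), fun a b h => e.injective (congrArg Prod.fst h)⟩,
    ?_, by simp⟩
  intro p hp q hq hne
  simp only [Finset.mem_map, Finset.mem_univ, true_and] at hp hq
  obtain ⟨a, rfl⟩ := hp
  obtain ⟨b, rfl⟩ := hq
  have hab : a ≠ b := by rintro rfl; exact hne rfl
  exact ⟨fun h => hab (e.injective h), fun h => hab (f.injective h)⟩

theorem SumsDistinct.exists_isBest_univ {x : ι × κ → ℝ} (hx : SumsDistinct x) {t : ℕ}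
    (h1 : t ≤ Fintype.card ι) (h2 : t ≤ Fintype.card κ) : ∃ S, IsBest x Finset.univ t S := by
  obtain ⟨S, hS, hc⟩ := exists_isMatching_card h1 h2
  exact hx.exists_isBest ⟨S, hS, hc, card_cols_sdiff_univ_le _⟩

/-- A matching that is best among those with at most one column outside its own column set
is best among all matchings. -/
theorem IsBest.univ_of_cols_eq {x : ι × κ → ℝ} (hx : SumsDistinct x) {K : Finset κ} {t : ℕ}
    {S : Finset (ι × κ)} (h : IsBest x K t S) (hK : cols S = K) :
    IsBest x Finset.univ t S := by
  have hdown : ∀ d ≤ t, ∃ S', IsBest x K (t - d) S' ∧ cols S' ⊆ K := by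
    intro d
    induction d with
    | zero => exact fun _ => ⟨S, h, hK.le⟩
    | succ d ih =>
      intro hd
      obtain ⟨S', hS', hsub⟩ := ih (by omega)
      obtain ⟨U, hUS, hUc⟩ := Finset.exists_subset_card_eq
        (show t - (d + 1) ≤ S'.card by rw [hS'.1.2.1]; omega)
      obtain ⟨V, hV⟩ := hx.exists_isBest (K := K) (t := t - (d + 1))
        ⟨U, hS'.1.1.mono hUS, hUc, by
          rw [Finset.sdiff_eq_empty_iff_subset.2 ((cols_mono hUS).trans hsub)]; simp⟩
      have hS'' : IsBest x K (t - (d + 1) + 1) S' := by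
        convert hS' using 1; omega
      obtain ⟨j, -, hj⟩ := hV.nested hS'' hsub
      exact ⟨V, hV, (Finset.subset_insert _ _).trans (hj ▸ hsub)⟩
  have hup : ∀ s ≤ t, ∃ S', IsBest x K s S' ∧ cols S' ⊆ K ∧ IsBest x Finset.univ s S' := by
    intro s
    induction s with
    | zero =>
      intro _
      obtain ⟨S', hS', hsub⟩ := hdown t le_rfl
      rw [Nat.sub_self] at hS'
      refine ⟨S', hS', hsub, ⟨hS'.1.1, hS'.1.2.1, card_cols_sdiff_univ_le _⟩, fun U hU hc _ hne => ?_⟩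
      exact absurd ((Finset.card_eq_zero.1 hc).trans (Finset.card_eq_zero.1 hS'.1.2.1).symm) hne
    | succ s ih =>
      intro hs
      obtain ⟨S', hS', hsub, hbest⟩ := ih (by omega)
      obtain ⟨V, hV, hVsub⟩ := hdown (t - (s + 1)) (by omega)
      rw [Nat.sub_sub_self hs] at hV
      obtain ⟨T, hT⟩ := hx.exists_isBest (K := Finset.univ) (t := s + 1)
        ⟨V, hV.1.1, hV.1.2.1, card_cols_sdiff_univ_le _⟩
      obtain ⟨j, -, hj⟩ := hbest.nested hT (Finset.subset_univ _)
      have hTc : (cols T \ K).card ≤ 1 := by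
        have : cols T \ K ⊆ {j} := by
          rw [hj]
          intro z hz
          simp only [Finset.mem_sdiff, Finset.mem_insert] at hz
          rcases hz with ⟨rfl | hz, hzK⟩
          · simp
          · exact absurd (hsub hz) hzK
        exact (Finset.card_le_card this).trans (by simp)
      have : V = T := hV.unique (hT.of_class (Finset.subset_univ _) hTc)
      exact ⟨V, hV, hVsub, this ▸ hT⟩
  obtain ⟨S', hS', -, hbest⟩ := hup t le_rfl
  rwa [h.unique hS']

theorem IsBest.univ_succ_iff {x : ι × κ → ℝ} (hx : SumsDistinct x) {K : Finset κ} {t : ℕ}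
    (h1 : t + 1 ≤ Fintype.card ι) (h2 : t + 1 ≤ Fintype.card κ)
    {S S' : Finset (ι × κ)} (h : IsBest x Finset.univ t S) (hK : cols S = K) :
    IsBest x Finset.univ (t + 1) S' ↔ IsBest x K (t + 1) S' := by
  have key : ∀ T, IsBest x Finset.univ (t + 1) T → IsBest x K (t + 1) T := by
    intro T hT
    obtain ⟨j, -, hj⟩ := h.nested hT (Finset.subset_univ _)
    refine hT.of_class (Finset.subset_univ _) ?_
    have : cols T \ K ⊆ {j} := by
      rw [hj, hK]
      intro z hz
      simp only [Finset.mem_sdiff, Finset.mem_insert] at hz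
      rcases hz with ⟨rfl | hz, hzK⟩
      · simp
      · exact absurd hz hzK
    exact (Finset.card_le_card this).trans (by simp)
  refine ⟨key S', fun hS' => ?_⟩
  obtain ⟨T, hT⟩ := hx.exists_isBest_univ h1 h2
  rwa [hS'.unique (key T hT)]

end Matchings

section Relocation

variable {ι κ : Type*} [DecidableEq ι] [DecidableEq κ]

theorem IsMatching.eq_of_card_le {S : Finset (ι × κ)} {K : Finset κ} (hS : IsMatching S)
    (hK : (cols S \ K).card ≤ 1) {p q : ι × κ} (hp : p ∈ S) (hq : q ∈ S) (hpK : p.2 ∉ K)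
    (hqK : q.2 ∉ K) : p = q := by
  refine hS.eq_of_snd hp hq ?_
  exact Finset.card_le_one.1 hK _ (Finset.mem_sdiff.2 ⟨Finset.mem_image_of_mem _ hp, hpK⟩) _
    (Finset.mem_sdiff.2 ⟨Finset.mem_image_of_mem _ hq, hqK⟩)

/-- Moving the only entry outside the columns `K` to another column outside `K`. -/
theorem IsMatching.relocate {S : Finset (ι × κ)} {K : Finset κ} (hS : IsMatching S)
    (hK : (cols S \ K).card ≤ 1) {i : ι} {a b : κ} (ha : (i, a) ∈ S) (haK : a ∉ K) (hbK : b ∉ K) :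
    ∃ T : Finset (ι × κ), IsMatching T ∧ T.card = S.card ∧ (cols T \ K).card ≤ 1 ∧
      (i, b) ∈ T ∧ ∀ x : ι × κ → ℝ, ∑ p ∈ T, x p = ∑ p ∈ S.erase (i, a), x p + x (i, b) := by
  have hout : ∀ p ∈ S.erase (i, a), p.2 ∈ K := by
    intro p hp
    obtain ⟨hne, hpS⟩ := Finset.mem_erase.1 hp
    by_contra hpK
    exact hne (hS.eq_of_card_le hK hpS ha hpK haK)
  have hsub : cols (S.erase (i, a)) ⊆ K := by
    intro j hj
    obtain ⟨i', hi'⟩ := mem_cols.1 hj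
    exact hout _ hi'
  have hb : b ∉ cols (S.erase (i, a)) := fun h => hbK (hsub h)
  have hi : i ∉ rows (S.erase (i, a)) := by rw [hS.rows_erase ha]; simp
  refine ⟨insert (i, b) (S.erase (i, a)), (hS.mono (Finset.erase_subset _ _)).insert_pair hi hb,
    ?_, ?_, Finset.mem_insert_self _ _, ?_⟩
  · rw [Finset.card_insert_of_notMem (notMem_of_notMem_cols hb), Finset.card_erase_add_one ha]
  · have : cols (insert (i, b) (S.erase (i, a))) \ K ⊆ {b} := by
      rw [cols_insert]
      intro z hz
      simp only [Finset.mem_sdiff, Finset.mem_insert] at hz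
      rcases hz with ⟨rfl | hz, hzK⟩
      · simp
      · exact absurd (hsub hz) hzK
    exact (Finset.card_le_card this).trans (by simp)
  · intro x
    rw [Finset.sum_insert (notMem_of_notMem_cols hb), add_comm]

/-- Replace all entries of row `i` outside the columns `K` by the value `s`. -/
def collapse (K : Finset κ) (i : ι) (s : ℝ) (x : ι × κ → ℝ) : ι × κ → ℝ :=
  fun q => if q.1 = i ∧ q.2 ∉ K then s else x q

/-- The matchings of size `t` with at most one column outside `K`. -/
def matchClass (ι : Type*) {κ : Type*} [DecidableEq κ] (K : Finset κ) (t : ℕ) :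
    Set (Finset (ι × κ)) :=
  {S | IsMatching S ∧ S.card = t ∧ (cols S \ K).card ≤ 1}

/-- `S` has an entry in row `i` outside the columns `K`. -/
def HasOuter (K : Finset κ) (i : ι) (S : Finset (ι × κ)) : Prop := ∃ j ∉ K, (i, j) ∈ S

theorem exists_sum_collapse {S : Finset (ι × κ)} {K : Finset κ} {t : ℕ}
    (hS : S ∈ matchClass ι K t) {i : ι} {b : κ} (hb : b ∉ K) (x : ι × κ → ℝ) :
    ∃ T ∈ matchClass ι K t, ∑ p ∈ T, x p = ∑ p ∈ S, collapse K i (x (i, b)) x p ∧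
      (HasOuter K i T ↔ HasOuter K i S) ∧ (cols T = K ↔ cols S = K) := by
  obtain ⟨hS, hc, hK⟩ := hS
  by_cases h : HasOuter K i S
  · obtain ⟨a, haK, ha⟩ := h
    obtain ⟨T, hT, hTc, hTK, hbT, hsum⟩ := hS.relocate hK ha haK hb
    refine ⟨T, ⟨hT, hTc.trans hc, hTK⟩, ?_, ⟨fun _ => ⟨a, haK, ha⟩, fun _ => ⟨b, hb, hbT⟩⟩,
      ⟨fun h => ?_, fun h => ?_⟩⟩
    · rw [hsum, ← Finset.sum_erase_add _ _ ha]
      congr 1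
      · refine Finset.sum_congr rfl fun p hp => ?_
        obtain ⟨hne, hpS⟩ := Finset.mem_erase.1 hp
        rw [collapse, if_neg]
        rintro ⟨-, hpK⟩
        exact hne (hS.eq_of_card_le hK hpS ha hpK haK)
      · simp [collapse, haK]
    · exact absurd (h ▸ mem_cols.2 ⟨i, hbT⟩) hb
    · exact absurd (h ▸ mem_cols.2 ⟨i, ha⟩) haK
  · refine ⟨S, ⟨hS, hc, hK⟩, Finset.sum_congr rfl fun p hp => ?_, Iff.rfl, Iff.rfl⟩
    rw [collapse, if_neg]
    rintro ⟨rfl, hpK⟩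
    exact h ⟨p.2, hpK, hp⟩

/-- Some member of `P` has smaller weight than all members of `Q`. -/
def Beats {α : Type*} (x : α → ℝ) (P Q : Set (Finset α)) : Prop :=
  ∃ S ∈ P, ∀ S' ∈ Q, ∑ p ∈ S, x p < ∑ p ∈ S', x p

theorem beats_congr {α : Type*} {x y : α → ℝ} {P Q : Set (Finset α)} (hyx : ∀ p, y p ≤ x p)
    (hP : ∀ S ∈ P, ∃ T ∈ P, ∑ p ∈ T, x p = ∑ p ∈ S, y p)
    (hQ : ∀ S ∈ Q, ∃ T ∈ Q, ∑ p ∈ T, x p = ∑ p ∈ S, y p) : Beats x P Q ↔ Beats y P Q := by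
  constructor
  · rintro ⟨S, hS, h⟩
    refine ⟨S, hS, fun S' hS' => ?_⟩
    obtain ⟨T, hT, e⟩ := hQ S' hS'
    rw [← e]
    exact (Finset.sum_le_sum fun p _ => hyx p).trans_lt (h T hT)
  · rintro ⟨S, hS, h⟩
    obtain ⟨T, hT, e⟩ := hP S hS
    refine ⟨T, hT, fun S' hS' => ?_⟩
    rw [e]
    exact (h S' hS').trans_le (Finset.sum_le_sum fun p _ => hyx p)

/-- The best matching of size `t` has columns `K`, and the best matching of size `t + 1` has
its entry outside `K` in row `i`, both among matchings with at most one column outside `K`. -/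
def GrowsAtRow (K : Finset κ) (t : ℕ) (i : ι) (x : ι × κ → ℝ) : Prop :=
  Beats x {S | S ∈ matchClass ι K t ∧ cols S = K} {S | S ∈ matchClass ι K t ∧ cols S ≠ K} ∧
    Beats x {S | S ∈ matchClass ι K (t + 1) ∧ HasOuter K i S}
      {S | S ∈ matchClass ι K (t + 1) ∧ ¬ HasOuter K i S}

theorem growsAtRow_collapse {K : Finset κ} {t : ℕ} {i : ι} {b : κ} (hb : b ∉ K) {x : ι × κ → ℝ}
    (hmin : ∀ j ∉ K, x (i, b) ≤ x (i, j)) :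
    GrowsAtRow K t i x ↔ GrowsAtRow K t i (collapse K i (x (i, b)) x) := by
  have hle : ∀ p, collapse K i (x (i, b)) x p ≤ x p := by
    rintro ⟨i', j⟩
    rw [collapse]
    split_ifs with h
    · obtain ⟨rfl, hj⟩ := h
      exact hmin j hj
    · exact le_rfl
  refine and_congr (beats_congr hle ?_ ?_) (beats_congr hle ?_ ?_) <;> rintro S ⟨hS, hS'⟩ <;>
    obtain ⟨T, hT, hsum, h1, h2⟩ := exists_sum_collapse hS (i := i) hb x
  · exact ⟨T, ⟨hT, h2.2 hS'⟩, hsum⟩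
  · exact ⟨T, ⟨hT, fun h => hS' (h2.1 h)⟩, hsum⟩
  · exact ⟨T, ⟨hT, h1.2 hS'⟩, hsum⟩
  · exact ⟨T, ⟨hT, fun h => hS' (h1.1 h)⟩, hsum⟩

theorem GrowsAtRow.row_unique {K : Finset κ} {t : ℕ} {i i' : ι} {x : ι × κ → ℝ}
    (h : GrowsAtRow K t i x) (h' : GrowsAtRow K t i' x) : i = i' := by
  by_contra hne
  obtain ⟨S, ⟨hS, a, haK, ha⟩, hlt⟩ := h.2
  obtain ⟨S', ⟨hS', b, hbK, hb⟩, hlt'⟩ := h'.2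
  have h1 := hlt S' ⟨hS', fun ⟨c, hcK, hc⟩ => hne
    (congrArg Prod.fst (hS'.1.eq_of_card_le hS'.2.2 hc hb hcK hbK))⟩
  have h2 := hlt' S ⟨hS, fun ⟨c, hcK, hc⟩ => hne
    (congrArg Prod.fst (hS.1.eq_of_card_le hS.2.2 ha hc haK hcK))⟩
  linarith

variable [Fintype ι] [Fintype κ]

/-- The columns of the best matching of size `t` are `K`. -/
def BestCols (x : ι × κ → ℝ) (t : ℕ) (K : Finset κ) : Prop :=
  ∃ S, IsBest x Finset.univ t S ∧ cols S = K

theorem bestCols_succ_iff {x : ι × κ → ℝ} (hx : SumsDistinct x) {K : Finset κ} {t : ℕ}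
    (h1 : t + 1 ≤ Fintype.card ι) (h2 : t + 1 ≤ Fintype.card κ) {j : κ} (hj : j ∉ K) :
    (BestCols x t K ∧ BestCols x (t + 1) (insert j K)) ↔
      ∃ i, GrowsAtRow K t i x ∧ ∀ j' ∉ K, j' ≠ j → x (i, j) < x (i, j') := by
  constructor
  · rintro ⟨⟨S, hS, hSK⟩, S', hS', hSK'⟩
    have hB : IsBest x K t S := hS.of_class (Finset.subset_univ _) (by simp [hSK])
    have hB' := (hS.univ_succ_iff hx h1 h2 hSK).1 hS'
    obtain ⟨i, hi⟩ := mem_cols.1 (hSK' ▸ Finset.mem_insert_self j K)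
    refine ⟨i, ⟨⟨S, ⟨hB.1, hSK⟩, fun T hT => hB.2 T hT.1.1 hT.1.2.1 hT.1.2.2 ?_⟩,
      ⟨S', ⟨hB'.1, j, hj, hi⟩, fun T hT => hB'.2 T hT.1.1 hT.1.2.1 hT.1.2.2 ?_⟩⟩, ?_⟩
    · rintro rfl; exact hT.2 hSK
    · rintro rfl; exact hT.2 ⟨j, hj, hi⟩
    · intro j' hj' hne
      obtain ⟨T, hT, hTc, hTK, hbT, hsum⟩ := hB'.1.1.relocate hB'.1.2.2 hi hj hj'
      have := hB'.2 T hT (hTc.trans hB'.1.2.1) hTK (by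
        rintro rfl
        exact hne (congrArg Prod.snd (hT.eq_of_card_le hTK hbT hi hj' hj)))
      rw [hsum, ← Finset.sum_erase_add _ _ hi] at this
      linarith
  · rintro ⟨i, ⟨⟨S, ⟨hS, hSK⟩, hlt⟩, ⟨S', ⟨hS', hSo⟩, hlt'⟩⟩, hmin⟩
    obtain ⟨V, hV⟩ := hx.exists_isBest ⟨S, hS⟩
    have hVK : cols V = K := by
      by_contra hne
      have h1 := hlt V ⟨hV.1, hne⟩
      have h2 := hV.2 S hS.1 hS.2.1 hS.2.2 (by rintro rfl; exact hne hSK)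
      linarith
    have hVu := hV.univ_of_cols_eq hx hVK
    obtain ⟨W, hW⟩ := hx.exists_isBest ⟨S', hS'⟩
    have hWu := (hVu.univ_succ_iff hx h1 h2 hVK).2 hW
    have hWo : HasOuter K i W := by
      by_contra hne
      have h1 := hlt' W ⟨hW.1, hne⟩
      have h2 := hW.2 S' hS'.1 hS'.2.1 hS'.2.2 (by rintro rfl; exact hne hSo)
      linarith
    obtain ⟨a, haK, ha⟩ := hWo
    have haj : a = j := by
      by_contra hne
      obtain ⟨T, hT, hTc, hTK, hbT, hsum⟩ := hW.1.1.relocate hW.1.2.2 ha haK hj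
      have h3 := hW.2 T hT (hTc.trans hW.1.2.1) hTK (by
        rintro rfl
        exact hne (congrArg Prod.snd (hT.eq_of_card_le hTK ha hbT haK hj)))
      rw [hsum, ← Finset.sum_erase_add _ _ ha] at h3
      have h4 := hmin a haK hne
      linarith
    subst haj
    refine ⟨⟨V, hVu, hVK⟩, W, hWu, ?_⟩
    obtain ⟨b, -, hb⟩ := hVu.nested hWu (Finset.subset_univ _)
    rw [hVK] at hb
    have : a ∈ insert b K := hb ▸ mem_cols.2 ⟨i, ha⟩
    rcases Finset.mem_insert.1 this with rfl | h
    · exact hb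
    · exact absurd h haK

end Relocation

section Exponential

open ProbabilityTheory

theorem lintegral_expMeasure {r : ℝ} (f : ℝ → ENNReal) :
    ∫⁻ s, f s ∂expMeasure r = ∫⁻ s, exponentialPDF r s * f s := by
  have : expMeasure r = volume.withDensity (exponentialPDF r) := rfl
  rw [this, lintegral_withDensity_eq_lintegral_mul_non_measurable]
  · rfl
  · exact (measurable_exponentialPDFReal r).ennreal_ofReal
  · exact Eventually.of_forall fun s => ENNReal.ofReal_lt_top

theorem expMeasure_Ioi {r : ℝ} (hr : 0 < r) {s : ℝ} (hs : 0 ≤ s) :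
    expMeasure r (Set.Ioi s) = ENNReal.ofReal (Real.exp (-(r * s))) := by
  have := isProbabilityMeasure_expMeasure hr
  have h := cdf_expMeasure_eq hr s
  rw [cdf_eq_real, if_pos hs] at h
  rw [← Set.compl_Iic, prob_compl_eq_one_sub measurableSet_Iic, ← ofReal_measureReal, h,
    ← ENNReal.ofReal_one, ← ENNReal.ofReal_sub _ (by simpa using by positivity)]
  congr 1; ring

theorem expMeasure_le {r : ℝ} (hr : 0 < r) (B : Set ℝ) :
    expMeasure r B ≤ ENNReal.ofReal r * volume B := by
  have : expMeasure r = volume.withDensity (exponentialPDF r) := rfl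
  rw [this]
  calc volume.withDensity (exponentialPDF r) B
      ≤ volume.withDensity (fun _ => ENNReal.ofReal r) B := by
        refine withDensity_mono (Eventually.of_forall fun s => ?_) B
        rw [exponentialPDF_eq]
        refine ENNReal.ofReal_le_ofReal ?_
        split_ifs with h
        · exact mul_le_of_le_one_right hr.le (Real.exp_le_one_iff.2 (by nlinarith))
        · exact hr.le
    _ = ENNReal.ofReal r * volume B := by
        rw [withDensity_const]; simp

variable {α : Type*} [Fintype α] [DecidableEq α]

/-- The law of independent exponential variables with the given rates. -/
noncomputable def expPi (rate : α → ℝ) : Measure (α → ℝ) :=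
  Measure.pi fun a => expMeasure (rate a)

theorem isProbabilityMeasure_expPi {rate : α → ℝ} (hr : ∀ a, 0 < rate a) :
    IsProbabilityMeasure (expPi rate) := by
  have := fun a => isProbabilityMeasure_expMeasure (hr a)
  unfold expPi; infer_instance

theorem lmarginal_argmin {rate : α → ℝ} (hr : ∀ a, 0 < rate a) {J : Finset α} {p : α}
    (hp : p ∈ J) {F : Set (α → ℝ)} (hF : MeasurableSet F)
    (hc : ∀ x, (∀ q ∈ J, x p ≤ x q) → (x ∈ F ↔ (fun q => if q ∈ J then x p else x q) ∈ F))
    (x : α → ℝ) :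
    (∫⋯∫⁻_J, Set.indicator {y | y ∈ F ∧ ∀ q ∈ J, q ≠ p → y p < y q} 1
        ∂fun a => expMeasure (rate a)) x =
      ENNReal.ofReal (rate p) * ∫⁻ s, ENNReal.ofReal (if 0 ≤ s then
        Real.exp (-((∑ q ∈ J, rate q) * s)) else 0) *
          F.indicator 1 (fun q => if q ∈ J then s else x q) := by
  have := fun a => isProbabilityMeasure_expMeasure (hr a)
  have hm : MeasurableSet {y : α → ℝ | y ∈ F ∧ ∀ q ∈ J, q ≠ p → y p < y q} := by
    refine hF.inter ?_
    have : {y : α → ℝ | ∀ q ∈ J, q ≠ p → y p < y q} =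
        ⋂ q ∈ J, ⋂ (_ : q ≠ p), {y : α → ℝ | y p < y q} := by ext; simp
    change MeasurableSet {y : α → ℝ | ∀ q ∈ J, q ≠ p → y p < y q}
    rw [this]
    exact Finset.measurableSet_biInter _ fun q _ => MeasurableSet.iInter fun _ =>
      measurableSet_lt (measurable_pi_apply _) (measurable_pi_apply _)
  rw [lmarginal_erase _ (measurable_one.indicator hm) hp, lintegral_expMeasure,
    ← lintegral_const_mul']
  swap
  · exact ENNReal.ofReal_ne_top
  refine lintegral_congr fun s => ?_
  rw [exponentialPDF_eq]
  split_ifs with hs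
  swap
  · simp
  have hin : (∫⋯∫⁻_J.erase p, Set.indicator {y | y ∈ F ∧ ∀ q ∈ J, q ≠ p → y p < y q} 1
      ∂fun a => expMeasure (rate a)) (Function.update x p s) =
      F.indicator 1 (fun q => if q ∈ J then s else x q) *
        ENNReal.ofReal (Real.exp (-((∑ q ∈ J.erase p, rate q) * s))) := by
    rw [lmarginal]
    have hpt : ∀ y : (i : J.erase p) → ℝ,
        Set.indicator {y | y ∈ F ∧ ∀ q ∈ J, q ≠ p → y p < y q} (1 : (α → ℝ) → ENNReal)
          (Function.updateFinset (Function.update x p s) (J.erase p) y) =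
        F.indicator 1 (fun q => if q ∈ J then s else x q) *
          (Set.pi Set.univ fun _ => Set.Ioi s).indicator 1 y := by
      intro y
      set z := Function.updateFinset (Function.update x p s) (J.erase p) y with hz
      have hzp : z p = s := by simp [hz, Function.updateFinset]
      have hzq : ∀ q (hq : q ∈ J.erase p), z q = y ⟨q, hq⟩ := by
        intro q hq; simp only [hz, Function.updateFinset]; rw [dif_pos hq]
      have hzo : ∀ q, q ∉ J → z q = x q := by
        intro q hq
        have h1 : q ≠ p := fun h => hq (h ▸ hp)
        simp [hz, Function.updateFinset, hq, h1]
      have hiff : (∀ q ∈ J, q ≠ p → z p < z q) ↔ y ∈ Set.pi Set.univ fun _ => Set.Ioi s := by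
        rw [hzp]
        constructor
        · rintro h ⟨q, hq⟩ -
          have := h q (Finset.mem_of_mem_erase hq) (Finset.ne_of_mem_erase hq)
          rwa [hzq q hq] at this
        · intro h q hq hne
          rw [hzq q (Finset.mem_erase.2 ⟨hne, hq⟩)]
          exact h ⟨q, Finset.mem_erase.2 ⟨hne, hq⟩⟩ trivial
      by_cases hy : y ∈ Set.pi Set.univ fun _ => Set.Ioi s
      · have hlt := hiff.2 hy
        have h2 := hc z (fun q hq => by
          by_cases h : q = p
          · rw [h]
          · exact (hlt q hq h).le)
        have h3 : (fun q => if q ∈ J then z p else z q) = fun q => if q ∈ J then s else x q := by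
          funext q
          split_ifs with h
          · exact hzp
          · exact hzo q h
        rw [h3] at h2
        rw [Set.indicator_of_mem hy]
        by_cases hzF : z ∈ F
        · rw [Set.indicator_of_mem (show z ∈ {y : α → ℝ | y ∈ F ∧ ∀ q ∈ J, q ≠ p → y p < y q} from
              ⟨hzF, hlt⟩),
            Set.indicator_of_mem (h2.1 hzF)]; simp
        · rw [Set.indicator_of_notMem (fun h => hzF h.1),
            Set.indicator_of_notMem (fun h => hzF (h2.2 h))]; simp
      · rw [Set.indicator_of_notMem hy, Set.indicator_of_notMem (fun h => hy (hiff.1 h.2))]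
        simp
    simp_rw [hpt]
    rw [lintegral_const_mul, lintegral_indicator_one, Measure.pi_pi]
    · congr 1
      simp_rw [expMeasure_Ioi (hr _) hs]
      rw [← ENNReal.ofReal_prod_of_nonneg (fun _ _ => (Real.exp_pos _).le), ← Real.exp_sum,
        Finset.sum_neg_distrib, ← Finset.sum_mul, Finset.sum_coe_sort (J.erase p) rate]
    · exact MeasurableSet.univ_pi fun _ => measurableSet_Ioi
    · exact measurable_one.indicator (MeasurableSet.univ_pi fun _ => measurableSet_Ioi)
  rw [hin, ENNReal.ofReal_mul (hr p).le, mul_assoc]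
  congr 1
  rw [mul_comm (F.indicator _ _), ← mul_assoc]
  congr 1
  rw [← ENNReal.ofReal_mul (Real.exp_pos _).le, ← Real.exp_add, ← Finset.add_sum_erase J rate hp]
  congr 2; ring

/-- Independence of the location of the minimum of exponential variables from any event
depending on them only through the value of the minimum. -/
theorem argmin_measure {rate : α → ℝ} (hr : ∀ a, 0 < rate a) {J : Finset α} {p p' : α}
    (hp : p ∈ J) (hp' : p' ∈ J) {F : Set (α → ℝ)} (hF : MeasurableSet F)
    (hc : ∀ p ∈ J, ∀ x, (∀ q ∈ J, x p ≤ x q) →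
      (x ∈ F ↔ (fun q => if q ∈ J then x p else x q) ∈ F)) :
    ENNReal.ofReal (rate p') * expPi rate {y | y ∈ F ∧ ∀ q ∈ J, q ≠ p → y p < y q} =
      ENNReal.ofReal (rate p) * expPi rate {y | y ∈ F ∧ ∀ q ∈ J, q ≠ p' → y p' < y q} := by
  have := fun a => isProbabilityMeasure_expMeasure (hr a)
  have hm : ∀ p, MeasurableSet {y : α → ℝ | y ∈ F ∧ ∀ q ∈ J, q ≠ p → y p < y q} := by
    intro p
    refine hF.inter ?_
    have : {y : α → ℝ | ∀ q ∈ J, q ≠ p → y p < y q} =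
        ⋂ q ∈ J, ⋂ (_ : q ≠ p), {y : α → ℝ | y p < y q} := by ext; simp
    change MeasurableSet {y : α → ℝ | ∀ q ∈ J, q ≠ p → y p < y q}
    rw [this]
    exact Finset.measurableSet_biInter _ fun q _ => MeasurableSet.iInter fun _ =>
      measurableSet_lt (measurable_pi_apply _) (measurable_pi_apply _)
  have hmi : ∀ p, Measurable (Set.indicator
      {y : α → ℝ | y ∈ F ∧ ∀ q ∈ J, q ≠ p → y p < y q} (1 : (α → ℝ) → ENNReal)) :=
    fun p => measurable_one.indicator (hm p)
  rw [← lintegral_indicator_one (hm p), ← lintegral_indicator_one (hm p'),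
    ← lintegral_const_mul _ (hmi p), ← lintegral_const_mul _ (hmi p')]
  refine lintegral_eq_of_lmarginal_eq J ((hmi p).const_mul _) ((hmi p').const_mul _) ?_
  funext x
  have h := fun (p : α) (hp : p ∈ J) => lmarginal_argmin hr hp hF (hc p hp) x
  have key : ∀ (a : ENNReal) (p : α), (∫⋯∫⁻_J, (fun y => a * Set.indicator
      {y | y ∈ F ∧ ∀ q ∈ J, q ≠ p → y p < y q} 1 y) ∂fun a => expMeasure (rate a)) x = a *
      (∫⋯∫⁻_J, Set.indicator {y | y ∈ F ∧ ∀ q ∈ J, q ≠ p → y p < y q} 1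
        ∂fun a => expMeasure (rate a)) x := by
    intro a p
    rw [lmarginal, lmarginal, lintegral_const_mul]
    exact (hmi p).comp measurable_updateFinset
  rw [key, key, h p hp, h p' hp', mul_left_comm]

/-- Small gaps between two fixed subset sums are unlikely when the rates are small. -/
theorem lintegral_gap_le {rate : α → ℝ} (hr : ∀ a, 0 < rate a) {S S' : Finset α} {p : α}
    (hp : p ∈ S) (hp' : p ∉ S') {φ : (α → ℝ) → ENNReal} (hφ : Measurable φ) {g : (α → ℝ) → ℝ}
    (hg : Measurable g) (hφp : ∀ x s, φ (Function.update x p s) = φ x)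
    (hgp : ∀ x s, g (Function.update x p s) = g x) :
    ∫⁻ x, φ x * Set.indicator {x | |∑ q ∈ S, x q - ∑ q ∈ S', x q| ≤ g x} 1 x ∂expPi rate ≤
      ∫⁻ x, φ x * (ENNReal.ofReal (rate p) * ENNReal.ofReal (2 * g x)) ∂expPi rate := by
  have := fun a => isProbabilityMeasure_expMeasure (hr a)
  have hms : MeasurableSet {x : α → ℝ | |∑ q ∈ S, x q - ∑ q ∈ S', x q| ≤ g x} := by
    refine measurableSet_le ?_ hg
    fun_prop
  have hm1 : Measurable fun x => φ x * Set.indicator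
      {x | |∑ q ∈ S, x q - ∑ q ∈ S', x q| ≤ g x} 1 x :=
    hφ.mul (measurable_one.indicator hms)
  have hm2 : Measurable fun x => φ x * (ENNReal.ofReal (rate p) * ENNReal.ofReal (2 * g x)) := by
    fun_prop
  refine lintegral_le_of_lmarginal_le {p} hm1 hm2 fun x => ?_
  rw [lmarginal_singleton, lmarginal_singleton]
  simp only [hφp, hgp]
  rw [lintegral_const, measure_univ, mul_one, lintegral_const_mul]
  swap
  · exact (measurable_one.indicator hms).comp (measurable_update x)
  gcongr
  have hsub : ∀ s, Set.indicator {x | |∑ q ∈ S, x q - ∑ q ∈ S', x q| ≤ g x}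
      (1 : (α → ℝ) → ENNReal) (Function.update x p s) =
      (Set.Icc (∑ q ∈ S', x q - ∑ q ∈ S.erase p, x q - g x)
        (∑ q ∈ S', x q - ∑ q ∈ S.erase p, x q + g x)).indicator 1 s := by
    intro s
    have h1 : ∑ q ∈ S, Function.update x p s q = s + ∑ q ∈ S.erase p, x q := by
      rw [← Finset.add_sum_erase S _ hp, Function.update_self]
      congr 1
      refine Finset.sum_congr rfl fun q hq => ?_
      rw [Function.update_of_ne (Finset.ne_of_mem_erase hq)]
    have h2 : ∑ q ∈ S', Function.update x p s q = ∑ q ∈ S', x q := by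
      refine Finset.sum_congr rfl fun q hq => ?_
      rw [Function.update_of_ne]
      rintro rfl
      exact hp' hq
    simp only [Set.indicator, Set.mem_ofPred_eq, h1, h2, hgp, Set.mem_Icc, abs_le, Pi.one_apply]
    congr 1
    apply propext
    constructor <;> rintro ⟨h3, h4⟩ <;> constructor <;> linarith
  simp_rw [hsub]
  rw [lintegral_indicator_one measurableSet_Icc]
  refine (expMeasure_le (hr p) _).trans ?_
  rw [Real.volume_Icc]
  gcongr
  linarith

/-- Almost surely, distinct sets of independent exponential variables have distinct sums. -/
theorem ae_sum_ne {rate : α → ℝ} (hr : ∀ a, 0 < rate a) :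
    ∀ᵐ x ∂expPi rate, ∀ S S' : Finset α, ∑ q ∈ S, x q = ∑ q ∈ S', x q → S = S' := by
  have key : ∀ S S' : Finset α, ∀ p ∈ S, p ∉ S' →
      ∀ᵐ x ∂expPi rate, ∑ q ∈ S, x q ≠ ∑ q ∈ S', x q := by
    intro S S' p hp hp'
    have h := lintegral_gap_le hr hp hp' (φ := fun _ => 1) measurable_const (g := fun _ => 0)
      measurable_const (fun _ _ => rfl) (fun _ _ => rfl)
    simp only [one_mul, mul_zero, ENNReal.ofReal_zero, lintegral_const, zero_mul] at h
    have hms : MeasurableSet {x : α → ℝ | |∑ q ∈ S, x q - ∑ q ∈ S', x q| ≤ 0} := by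
      refine measurableSet_le ?_ measurable_const
      fun_prop
    rw [lintegral_indicator_one hms] at h
    rw [ae_iff]
    refine measure_mono_null (fun x hx => ?_) (le_antisymm h bot_le)
    simp only [ne_eq, Set.mem_ofPred_eq, not_not] at hx ⊢
    simp [hx]
  have hall : ∀ S S' : Finset α, ∀ᵐ x ∂expPi rate, ∑ q ∈ S, x q = ∑ q ∈ S', x q → S = S' := by
    intro S S'
    by_cases hSS : S = S'
    · exact Eventually.of_forall fun _ _ => hSS
    by_cases hsub : S ⊆ S'
    · obtain ⟨p, hp, hp'⟩ := Finset.not_subset.1 (fun h => hSS (hsub.antisymm h))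
      filter_upwards [key S' S p hp hp'] with x hx h using absurd h.symm hx
    · obtain ⟨p, hp, hp'⟩ := Finset.not_subset.1 hsub
      filter_upwards [key S S' p hp hp'] with x hx h using absurd h hx
  exact ae_all_iff.2 fun S => ae_all_iff.2 fun S' => hall S S'

end Exponential

section Urn

theorem prList_concat (c : ℕ → ℝ) (L : List ℕ) (j : ℕ) :
    ∀ C : ℝ, prList c C (L ++ [j]) = prList c C L * (c j / (C - (L.map c).sum)) := by
  induction L with
  | nil => intro C; simp [prList]
  | cons i L ih =>
    intro C
    rw [List.cons_append, prList, ih, prList, List.map_cons, List.sum_cons, mul_assoc, sub_sub]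

theorem prSetN_eq_sum (c : ℕ → ℝ) (n : ℕ) (K : Finset ℕ) :
    prSetN c n K = ∑ L ∈ K.toList.permutations.toFinset,
      prList c (∑ j ∈ Finset.range n, c j) L := by
  rw [prSetN, List.sum_toFinset]
  exact List.nodup_permutations _ K.nodup_toList

theorem mem_toFinset_permutations_toList {K : Finset ℕ} {L : List ℕ} :
    L ∈ K.toList.permutations.toFinset ↔ L.Nodup ∧ L.toFinset = K := by
  rw [List.mem_toFinset, List.mem_permutations]
  constructor
  · intro h
    exact ⟨h.nodup_iff.2 K.nodup_toList, by rw [List.toFinset_eq_of_perm _ _ h, K.toList_toFinset]⟩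
  · rintro ⟨h, rfl⟩
    exact (List.toFinset_toList h).symm

theorem prSetN_empty (c : ℕ → ℝ) (n : ℕ) : prSetN c n ∅ = 1 := by
  simp [prSetN, prList]

theorem prSetN_eq_sum_erase (c : ℕ → ℝ) (n : ℕ) {K : Finset ℕ} (hK : K.Nonempty) :
    prSetN c n K = ∑ j ∈ K, prSetN c n (K.erase j) *
      (c j / (∑ i ∈ Finset.range n, c i - ∑ i ∈ K.erase j, c i)) := by
  simp_rw [prSetN_eq_sum, Finset.sum_mul]
  rw [Finset.sum_sigma']
  symm
  refine Finset.sum_bij (fun p _ => p.2 ++ [p.1]) ?_ ?_ ?_ ?_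
  · rintro ⟨j, L⟩ h
    rw [Finset.mem_sigma, mem_toFinset_permutations_toList] at h
    rw [mem_toFinset_permutations_toList]
    obtain ⟨hj, hn, hL⟩ := h
    simp only at hj hn hL
    have hjL : j ∉ L := by
      rw [← List.mem_toFinset, hL]; simp
    refine ⟨List.nodup_append.2 ⟨hn, List.nodup_singleton j, fun a ha b hb h => hjL ?_⟩, ?_⟩
    · have hbj : b = j := List.mem_singleton.1 hb
      rw [← hbj, ← h]; exact ha
    rw [List.toFinset_append, hL]
    ext a; by_cases h : a = j <;> simp [h, hj]
  · rintro ⟨j, L⟩ _ ⟨j', L'⟩ _ h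
    obtain ⟨h1, h2⟩ := List.append_inj' h rfl
    simp only [List.cons.injEq, and_true] at h1 h2
    rw [h1, h2]
  · intro L hL
    rw [mem_toFinset_permutations_toList] at hL
    obtain ⟨hn, hL⟩ := hL
    rcases List.eq_nil_or_concat' L with rfl | ⟨L', j, rfl⟩
    · simp at hL; exact absurd hL.symm hK.ne_empty
    · have hjL : j ∉ L' := by
        intro h
        exact (List.nodup_append.1 hn).2.2 j h j (by simp) rfl
      refine ⟨⟨j, L'⟩, ?_, rfl⟩
      rw [Finset.mem_sigma, mem_toFinset_permutations_toList]
      refine ⟨by rw [← hL]; simp, (List.nodup_append.1 hn).1, ?_⟩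
      rw [← hL, List.toFinset_append]
      ext a
      by_cases h : a = j
      · simp [h, hjL]
      · simp [h]
  · rintro ⟨j, L⟩ h
    rw [Finset.mem_sigma, mem_toFinset_permutations_toList] at h
    obtain ⟨hj, hn, hL⟩ := h
    simp only at hj hn hL
    rw [prList_concat, ← hL, List.sum_toFinset c hn]

end Urn

section ColumnLaw

variable {ι κ : Type*} [Fintype ι] [Fintype κ] [DecidableEq ι] [DecidableEq κ]

theorem measureReal_eq_sum {Ω β : Type*} [MeasurableSpace Ω] {μ : Measure Ω} [IsFiniteMeasure μ]
    {s : Finset β} {E : Set Ω} {f : β → Set Ω} (hf : ∀ j ∈ s, MeasurableSet (f j))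
    (hE : ∀ᵐ x ∂μ, x ∈ E ↔ ∃ j ∈ s, x ∈ f j)
    (hd : ∀ j ∈ s, ∀ j' ∈ s, ∀ x, x ∈ f j → x ∈ f j' → j = j') :
    μ.real E = ∑ j ∈ s, μ.real (f j) := by
  rw [← measureReal_biUnion_finset _ hf]
  · refine measureReal_congr ?_
    filter_upwards [hE] with x hx
    refine propext (hx.trans ?_)
    change _ ↔ x ∈ ⋃ j ∈ s, f j
    simp
  · intro j hj j' hj' hne
    exact Set.disjoint_left.2 fun x hx hx' => hne (hd j hj j' hj' x hx hx')

theorem measurableSet_beats {α : Type*} [Fintype α] (P Q : Set (Finset α)) :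
    MeasurableSet {x : α → ℝ | Beats x P Q} := by
  have : {x : α → ℝ | Beats x P Q} =
      ⋃ S ∈ P, ⋂ S' ∈ Q, {x | ∑ p ∈ S, x p < ∑ p ∈ S', x p} := by
    ext; simp [Beats]
  rw [this]
  refine MeasurableSet.biUnion (Set.to_countable _) fun S _ =>
    MeasurableSet.biInter (Set.to_countable _) fun S' _ => measurableSet_lt ?_ ?_ <;> fun_prop

theorem measurableSet_growsAtRow (K : Finset κ) (t : ℕ) (i : ι) :
    MeasurableSet {x : ι × κ → ℝ | GrowsAtRow K t i x} :=
  (measurableSet_beats _ _).inter (measurableSet_beats _ _)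

theorem measurableSet_isBest (K : Finset κ) (t : ℕ) (S : Finset (ι × κ)) :
    MeasurableSet {x : ι × κ → ℝ | IsBest x K t S} := by
  have : {x : ι × κ → ℝ | IsBest x K t S} =
      {x | (IsMatching S ∧ S.card = t ∧ (cols S \ K).card ≤ 1)} ∩
      ⋂ S' ∈ {S' : Finset (ι × κ) | IsMatching S' ∧ S'.card = t ∧ (cols S' \ K).card ≤ 1 ∧
        S' ≠ S}, {x | ∑ p ∈ S, x p < ∑ p ∈ S', x p} := by
    ext; simp [IsBest]
  rw [this]
  refine (MeasurableSet.const _).inter <|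
    MeasurableSet.biInter (Set.to_countable _) fun S' _ => measurableSet_lt ?_ ?_ <;> fun_prop

theorem measurableSet_bestCols (t : ℕ) (K : Finset κ) :
    MeasurableSet {x : ι × κ → ℝ | BestCols x t K} := by
  have : {x : ι × κ → ℝ | BestCols x t K} =
      ⋃ S ∈ {S : Finset (ι × κ) | cols S = K}, {x | IsBest x Finset.univ t S} := by
    ext; simp [BestCols, and_comm]
  rw [this]
  exact MeasurableSet.biUnion (Set.to_countable _) fun S _ => measurableSet_isBest _ _ _

theorem BestCols.unique {x : ι × κ → ℝ} {t : ℕ} {K K' : Finset κ} (h : BestCols x t K)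
    (h' : BestCols x t K') : K = K' := by
  obtain ⟨S, hS, rfl⟩ := h
  obtain ⟨S', hS', rfl⟩ := h'
  rw [hS.unique hS']

theorem SumsDistinct.exists_bestCols {x : ι × κ → ℝ} (hx : SumsDistinct x) {t : ℕ}
    (h1 : t ≤ Fintype.card ι) (h2 : t ≤ Fintype.card κ) : ∃ K, BestCols x t K := by
  obtain ⟨S, hS⟩ := hx.exists_isBest_univ h1 h2
  exact ⟨_, S, hS, rfl⟩

theorem BestCols.card_eq {x : ι × κ → ℝ} {t : ℕ} {K : Finset κ} (h : BestCols x t K) :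
    K.card = t := by
  obtain ⟨S, hS, rfl⟩ := h
  rw [hS.1.1.card_cols, hS.1.2.1]

theorem BestCols.nested {x : ι × κ → ℝ} {t : ℕ} {K K' : Finset κ} (h : BestCols x t K)
    (h' : BestCols x (t + 1) K') : ∃ j ∉ K, K' = insert j K := by
  obtain ⟨S, hS, rfl⟩ := h
  obtain ⟨S', hS', rfl⟩ := h'
  exact hS.nested hS' (Finset.subset_univ _)

variable {a : ι → ℝ} {b : κ → ℝ}

/-- The law of the column which is added to the set of columns of the optimal matching. -/
theorem measureReal_bestCols_insert (ha : ∀ i, 0 < a i) (hb : ∀ j, 0 < b j) {t : ℕ}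
    (h1 : t + 1 ≤ Fintype.card ι) (h2 : t + 1 ≤ Fintype.card κ) {K : Finset κ} {j : κ}
    (hj : j ∉ K) :
    (expPi fun p : ι × κ => a p.1 * b p.2).real {x | BestCols x t K ∧
        BestCols x (t + 1) (insert j K)} =
      (expPi fun p : ι × κ => a p.1 * b p.2).real {x | BestCols x t K} *
        (b j / (∑ j, b j - ∑ j ∈ K, b j)) := by
  have hr : ∀ p : ι × κ, 0 < a p.1 * b p.2 := fun p => mul_pos (ha _) (hb _)
  set μ := expPi fun p : ι × κ => a p.1 * b p.2 with hμ
  have : IsProbabilityMeasure μ := isProbabilityMeasure_expPi hr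
  have hd : ∀ᵐ x ∂μ, SumsDistinct x := ae_sum_ne hr
  set A : κ → Set (ι × κ → ℝ) := fun j => {x | BestCols x t K ∧ BestCols x (t + 1) (insert j K)}
    with hA
  set G : ι → κ → Set (ι × κ → ℝ) := fun i j =>
    {x | x ∈ {x | GrowsAtRow K t i x} ∧ ∀ q ∈ ({i} ×ˢ Kᶜ : Finset (ι × κ)), q ≠ (i, j) →
      x (i, j) < x q} with hG
  have hGm : ∀ i j, MeasurableSet (G i j) := by
    intro i j
    refine (measurableSet_growsAtRow K t i).inter ?_
    have : {x : ι × κ → ℝ | ∀ q ∈ ({i} ×ˢ Kᶜ : Finset (ι × κ)), q ≠ (i, j) → x (i, j) < x q} =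
        ⋂ q ∈ ({i} ×ˢ Kᶜ : Finset (ι × κ)), ⋂ (_ : q ≠ (i, j)), {x | x (i, j) < x q} := by
      ext; simp
    change MeasurableSet {x : ι × κ → ℝ | ∀ q ∈ ({i} ×ˢ Kᶜ : Finset (ι × κ)), q ≠ (i, j) →
      x (i, j) < x q}
    rw [this]
    exact Finset.measurableSet_biInter _ fun q _ => MeasurableSet.iInter fun _ =>
      measurableSet_lt (measurable_pi_apply _) (measurable_pi_apply _)
  have hAG : ∀ j ∉ K, μ.real (A j) = ∑ i, μ.real (G i j) := by
    intro j hj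
    refine measureReal_eq_sum (fun i _ => hGm i j) ?_ ?_
    · filter_upwards [hd] with x hx
      refine (bestCols_succ_iff hx h1 h2 hj).trans ?_
      simp only [Finset.mem_univ, true_and, hG, Set.mem_ofPred_eq, Finset.mem_product,
        Finset.mem_singleton, Finset.mem_compl, Prod.forall, Prod.mk.injEq, ne_eq]
      refine exists_congr fun i => and_congr_right fun _ => ?_
      constructor
      · rintro h i' j' ⟨rfl, hj'⟩ hne
        exact h j' hj' fun h => hne ⟨rfl, h⟩
      · intro h j' hj' hne
        exact h i j' ⟨rfl, hj'⟩ fun h => hne h.2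
    · intro i _ i' _ x hx hx'
      exact hx.1.row_unique hx'.1
  have hGG : ∀ i, ∀ j ∉ K, ∀ j' ∉ K, b j' * μ.real (G i j) = b j * μ.real (G i j') := by
    intro i j hj j' hj'
    have hmem : ∀ j ∉ K, (i, j) ∈ ({i} ×ˢ Kᶜ : Finset (ι × κ)) := by
      intro j hj; simp [hj]
    have h := argmin_measure hr (hmem j hj) (hmem j' hj') (measurableSet_growsAtRow K t i) (by
      rintro ⟨i', b⟩ hp x hx
      simp only [Finset.mem_product, Finset.mem_singleton, Finset.mem_compl] at hp
      obtain ⟨rfl, hbK⟩ := hp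
      have := growsAtRow_collapse (t := t) hbK (x := x) (fun j hj => hx (i', j) (hmem j hj))
      refine this.trans ?_
      change _ ↔ GrowsAtRow K t i' _
      have he : collapse K i' (x (i', b)) x = fun q =>
          if q ∈ ({i'} ×ˢ Kᶜ : Finset (ι × κ)) then x (i', b) else x q := by
        funext q
        simp only [collapse, Finset.mem_product, Finset.mem_singleton, Finset.mem_compl]
      rw [he])
    have h' := congrArg ENNReal.toReal h
    rw [ENNReal.toReal_mul, ENNReal.toReal_mul, ENNReal.toReal_ofReal (hr (i, j')).le,
      ENNReal.toReal_ofReal (hr (i, j)).le] at h'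
    have h'' : a i * b j' * μ.real (G i j) = a i * b j * μ.real (G i j') := h'
    rw [mul_assoc, mul_assoc] at h''
    exact mul_left_cancel₀ (ha i).ne' h''
  have hAA : ∀ j' ∉ K, b j' * μ.real (A j) = b j * μ.real (A j') := by
    intro j' hj'
    rw [hAG j hj, hAG j' hj', Finset.mul_sum, Finset.mul_sum]
    exact Finset.sum_congr rfl fun i _ => hGG i j hj j' hj'
  have hsum : μ.real {x | BestCols x t K} = ∑ j ∈ Kᶜ, μ.real (A j) := by
    refine measureReal_eq_sum (fun j _ => (measurableSet_bestCols t K).inter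
      (measurableSet_bestCols (t + 1) (insert j K))) ?_ ?_
    · filter_upwards [hd] with x hx
      constructor
      · intro h
        obtain ⟨K', hK'⟩ := hx.exists_bestCols h1 h2
        obtain ⟨j, hj, rfl⟩ := BestCols.nested h hK'
        exact ⟨j, Finset.mem_compl.2 hj, h, hK'⟩
      · rintro ⟨j, _, h⟩
        exact h.1
    · intro j hj j' hj' x hx hx'
      have h := hx.2.unique hx'.2
      have : j ∈ insert j' K := h ▸ Finset.mem_insert_self j K
      rcases Finset.mem_insert.1 this with h | h
      · exact h
      · exact absurd h (Finset.mem_compl.1 hj)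
  have hB : ∑ j, b j - ∑ j ∈ K, b j = ∑ j ∈ Kᶜ, b j := by
    rw [← Finset.sum_add_sum_compl K b]; ring
  have hBpos : 0 < ∑ j ∈ Kᶜ, b j :=
    Finset.sum_pos (fun j _ => hb j) ⟨j, Finset.mem_compl.2 hj⟩
  rw [hB, hsum, mul_div_assoc', eq_div_iff hBpos.ne', mul_comm, Finset.sum_mul, Finset.sum_mul]
  refine Finset.sum_congr rfl fun j' hj' => ?_
  rw [hAA j' (Finset.mem_compl.1 hj'), mul_comm]

theorem measureReal_bestCols_succ (ha : ∀ i, 0 < a i) (hb : ∀ j, 0 < b j) {t : ℕ}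
    (h1 : t + 1 ≤ Fintype.card ι) (h2 : t + 1 ≤ Fintype.card κ) (K : Finset κ) :
    (expPi fun p : ι × κ => a p.1 * b p.2).real {x | BestCols x (t + 1) K} =
      ∑ j ∈ K, (expPi fun p : ι × κ => a p.1 * b p.2).real {x | BestCols x t (K.erase j)} *
        (b j / (∑ j, b j - ∑ i ∈ K.erase j, b i)) := by
  have hr : ∀ p : ι × κ, 0 < a p.1 * b p.2 := fun p => mul_pos (ha _) (hb _)
  have : IsProbabilityMeasure (expPi fun p : ι × κ => a p.1 * b p.2) :=
    isProbabilityMeasure_expPi hr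
  have hd : ∀ᵐ x ∂(expPi fun p : ι × κ => a p.1 * b p.2), SumsDistinct x := ae_sum_ne hr
  rw [measureReal_eq_sum (s := K) (f := fun j => {x | BestCols x t (K.erase j) ∧
    BestCols x (t + 1) K}) (fun j _ => (measurableSet_bestCols t _).inter
      (measurableSet_bestCols (t + 1) K))]
  · refine Finset.sum_congr rfl fun j hj => ?_
    rw [← measureReal_bestCols_insert ha hb h1 h2 (Finset.notMem_erase j K),
      Finset.insert_erase hj]
  · filter_upwards [hd] with x hx
    constructor
    · intro h
      obtain ⟨K', hK'⟩ := hx.exists_bestCols (t.le_succ.trans h1) (t.le_succ.trans h2)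
      obtain ⟨j, hj, rfl⟩ := BestCols.nested hK' h
      exact ⟨j, Finset.mem_insert_self _ _, by rwa [Finset.erase_insert hj], h⟩
    · rintro ⟨j, _, h⟩
      exact h.2
  · intro j hj j' hj' x hx hx'
    have h := hx.1.unique hx'.1
    by_contra hne
    have : j ∈ K.erase j' := Finset.mem_erase.2 ⟨hne, hj⟩
    rw [← h] at this
    simp at this

theorem measureReal_bestCols_zero (ha : ∀ i, 0 < a i) (hb : ∀ j, 0 < b j) :
    (expPi fun p : ι × κ => a p.1 * b p.2).real {x | BestCols x 0 ∅} = 1 := by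
  have hr : ∀ p : ι × κ, 0 < a p.1 * b p.2 := fun p => mul_pos (ha _) (hb _)
  have : IsProbabilityMeasure (expPi fun p : ι × κ => a p.1 * b p.2) :=
    isProbabilityMeasure_expPi hr
  have : {x : ι × κ → ℝ | BestCols x 0 ∅} = Set.univ := by
    refine Set.eq_univ_of_forall fun x => ⟨∅, ⟨⟨?_, rfl, by simp [cols]⟩, ?_⟩, by simp [cols]⟩
    · intro p hp; simp at hp
    · intro S' _ h _ hne
      exact absurd (Finset.card_eq_zero.1 h) hne
  rw [this]; simp

/-- The law of the set of columns of the optimal `t`-matching is the urn law. -/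
theorem measureReal_bestCols {n : ℕ} {c : ℕ → ℝ} (ha : ∀ i, 0 < a i) (hc : ∀ j < n, 0 < c j)
    {t : ℕ} (h1 : t ≤ Fintype.card ι) (h2 : t ≤ n) : ∀ K : Finset (Fin n), K.card = t →
    (expPi fun p : ι × Fin n => a p.1 * c p.2).real {x | BestCols x t K} =
      prSetN c n (K.map Fin.valEmbedding) := by
  induction t with
  | zero =>
    intro K hK
    rw [Finset.card_eq_zero.1 hK, Finset.map_empty, prSetN_empty]
    exact measureReal_bestCols_zero (b := fun j : Fin n => c j) ha fun j => hc j j.2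
  | succ t ih =>
    intro K hK
    have hne : (K.map Fin.valEmbedding).Nonempty := by
      rw [Finset.map_nonempty, ← Finset.card_pos]; omega
    rw [measureReal_bestCols_succ (b := fun j : Fin n => c j) ha (fun j => hc j j.2) h1
      (by simpa using h2), prSetN_eq_sum_erase c n hne, Finset.sum_map]
    refine Finset.sum_congr rfl fun j hj => ?_
    rw [ih (t.le_succ.trans h1) (t.le_succ.trans h2) _ (by rw [Finset.card_erase_of_mem hj]; omega),
      Finset.map_erase, Fin.sum_univ_eq_sum_range, ← Finset.map_erase, Finset.sum_map]
    rfl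

end ColumnLaw

section Product

open ProbabilityTheory

variable {α β γ : Type*} [Fintype α] [Fintype β] [Fintype γ] [DecidableEq α]

theorem memLp_two_expMeasure {r : ℝ} (hr : 0 < r) : MemLp (fun x => x) 2 (expMeasure r) := by
  have := isProbabilityMeasure_expMeasure hr
  rw [memLp_two_iff_integrable_sq measurable_id'.aestronglyMeasurable]
  have hd : expMeasure r = volume.withDensity (exponentialPDF r) := rfl
  rw [hd, integrable_withDensity_iff (f := exponentialPDF r)
    (measurable_exponentialPDFReal r).ennreal_ofReal
    (Eventually.of_forall fun s => ENNReal.ofReal_lt_top)]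
  have h : IntegrableOn (fun x => r * (x ^ (2 : ℝ) * Real.exp (-r * x ^ (1 : ℝ)))) (Set.Ioi 0) :=
    (integrableOn_rpow_mul_exp_neg_mul_rpow (s := 2) (p := 1) (b := r) (by norm_num)
    one_pos hr).const_mul r
  replace h := (integrable_indicator_iff measurableSet_Ici).2
    ((integrableOn_Ici_iff_integrableOn_Ioi (by finiteness)).2 h)
  refine h.congr (Eventually.of_forall fun x => ?_)
  simp only [Set.indicator, Set.mem_Ici]
  rw [exponentialPDF_eq]
  split_ifs with hx
  · rw [ENNReal.toReal_ofReal (by positivity)]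
    simp only [Real.rpow_two, Real.rpow_one]
    rw [neg_mul]; ring
  · simp

theorem ae_nonneg_expMeasure {r : ℝ} : ∀ᵐ x ∂expMeasure r, 0 ≤ x := by
  have h : ∫⁻ s, (Set.Iio 0).indicator 1 s ∂expMeasure r = 0 := by
    rw [lintegral_expMeasure]
    refine (lintegral_congr fun s => ?_).trans lintegral_zero
    rw [exponentialPDF_eq]
    by_cases hs : 0 ≤ s
    · rw [Set.indicator_of_notMem (by simpa using hs), mul_zero]
    · rw [if_neg hs]; simp
  rw [lintegral_indicator_one measurableSet_Iio] at h
  rw [ae_iff]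
  simpa [Set.Iio] using h

variable {rate : α → ℝ}

theorem measurePreserving_eval_expPi (hr : ∀ a, 0 < rate a) (a : α) :
    MeasurePreserving (fun x : α → ℝ => x a) (expPi rate) (expMeasure (rate a)) := by
  have := fun a => isProbabilityMeasure_expMeasure (hr a)
  exact measurePreserving_eval _ a

theorem memLp_two_expPi (hr : ∀ a, 0 < rate a) (s : Finset α) :
    MemLp (fun x : α → ℝ => ∑ a ∈ s, x a) 2 (expPi rate) :=
  memLp_finsetSum _ fun a _ =>
    (memLp_two_expMeasure (hr a)).comp_measurePreserving (measurePreserving_eval_expPi hr a)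

theorem ae_nonneg_expPi (hr : ∀ a, 0 < rate a) : ∀ᵐ x ∂expPi rate, ∀ a, 0 ≤ x a :=
  ae_all_iff.2 fun a => (measurePreserving_eval_expPi hr a).quasiMeasurePreserving.ae
    ae_nonneg_expMeasure

theorem iIndepFun_expPi (hr : ∀ a, 0 < rate a) :
    iIndepFun (fun a (x : α → ℝ) => x a) (expPi rate) := by
  have := fun a => isProbabilityMeasure_expMeasure (hr a)
  exact iIndepFun_pi (X := fun _ x => x) fun _ => measurable_id.aemeasurable

theorem measurePreserving_comp_expPi (hr : ∀ a, 0 < rate a) {e : β → α}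
    (he : Function.Injective e) :
    MeasurePreserving (fun (x : α → ℝ) b => x (e b)) (expPi rate)
      (expPi fun b => rate (e b)) := by
  have hm : Measurable (fun (x : α → ℝ) b => x (e b)) := by fun_prop
  refine ⟨hm, ?_⟩
  have := isProbabilityMeasure_expPi hr
  have h := (iIndepFun_expPi hr).precomp he
  rw [iIndepFun_iff_map_fun_eq_pi_map (fun b => (measurable_pi_apply _).aemeasurable)] at h
  refine h.trans ?_
  unfold expPi
  congr 1
  funext b
  exact (measurePreserving_eval_expPi hr (e b)).map_eq

theorem indepFun_comp_expPi (hr : ∀ a, 0 < rate a) {e : β → α} {e' : γ → α}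
    (h : ∀ b c, e b ≠ e' c) :
    IndepFun (fun (x : α → ℝ) b => x (e b)) (fun (x : α → ℝ) c => x (e' c)) (expPi rate) := by
  classical
  have hd : Disjoint (Finset.univ.image e) (Finset.univ.image e') := by
    rw [Finset.disjoint_left]
    intro a ha ha'
    obtain ⟨b, _, rfl⟩ := Finset.mem_image.1 ha
    obtain ⟨c, _, hc⟩ := Finset.mem_image.1 ha'
    exact h b c hc.symm
  have hi := (iIndepFun_expPi hr).indepFun_finset _ _ hd fun a => measurable_pi_apply a
  exact hi.comp (φ := fun y b => y ⟨e b, Finset.mem_image_of_mem _ (Finset.mem_univ b)⟩)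
    (ψ := fun y c => y ⟨e' c, Finset.mem_image_of_mem _ (Finset.mem_univ c)⟩)
    (by fun_prop) (by fun_prop)

end Product

section Assignment

open ProbabilityTheory

theorem rankOneMeasure_eq_expPi {m n : ℕ} {r c : ℕ → ℝ} (hr : ∀ i < m, 0 < r i)
    (hc : ∀ j < n, 0 < c j) :
    rankOneMeasure m n r c = expPi fun p : Fin m × Fin n => r p.1.val * c p.2.val := by
  have hp : ∀ p : Fin m × Fin n, 0 < r p.1.val * c p.2.val :=
    fun p => mul_pos (hr _ p.1.2) (hc _ p.2.2)
  have := fun p => isProbabilityMeasure_expMeasure (hp p)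
  refine (Measure.pi_eq fun s hs => ?_).symm
  set f : Fin m × Fin n → ℝ → ℝ := fun p x =>
    if 0 ≤ x then (r p.1.val * c p.2.val) * Real.exp (-((r p.1.val * c p.2.val) * x)) else 0
    with hf
  have hf0 : ∀ p x, 0 ≤ f p x := by
    intro p x
    simp only [hf]
    split_ifs
    · exact mul_nonneg (hp p).le (Real.exp_pos _).le
    · exact le_rfl
  have hfe : ∀ p x, ENNReal.ofReal (f p x) = exponentialPDF (r p.1.val * c p.2.val) x :=
    fun p x => (exponentialPDF_eq _ _).symm
  have hfm : ∀ p, Measurable (f p) := fun p =>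
    Measurable.ite measurableSet_Ici (by fun_prop) measurable_const
  have hfi : ∀ p, Integrable (f p) := by
    intro p
    refine ⟨(hfm p).aestronglyMeasurable, ?_⟩
    rw [hasFiniteIntegral_iff_ofReal (Eventually.of_forall (hf0 p))]
    simp_rw [hfe]
    rw [lintegral_exponentialPDF_eq_one (hp p)]
    exact ENNReal.one_lt_top
  have hgi : ∀ p, Integrable ((s p).indicator (f p)) := fun p => (hfi p).indicator (hs p)
  have hg0 : ∀ p x, 0 ≤ (s p).indicator (f p) x := fun p x =>
    Set.indicator_nonneg (fun x _ => hf0 p x) x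
  rw [rankOneMeasure, withDensity_apply _ (MeasurableSet.univ_pi hs),
    ← lintegral_indicator (MeasurableSet.univ_pi hs)]
  have hpt : ∀ x : Fin m × Fin n → ℝ, (Set.pi Set.univ s).indicator
      (fun x => ENNReal.ofReal (∏ p, f p (x p))) x =
      ENNReal.ofReal (∏ p, (s p).indicator (f p) (x p)) := by
    intro x
    by_cases hx : x ∈ Set.pi Set.univ s
    · rw [Set.indicator_of_mem hx]
      congr 1
      refine Finset.prod_congr rfl fun p _ => ?_
      rw [Set.indicator_of_mem (hx p trivial)]
    · rw [Set.indicator_of_notMem hx]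
      simp only [Set.mem_pi, Set.mem_univ, true_implies, not_forall] at hx
      obtain ⟨p, hxp⟩ := hx
      rw [Finset.prod_eq_zero (Finset.mem_univ p) (Set.indicator_of_notMem hxp _),
        ENNReal.ofReal_zero]
  have hint : Integrable (fun x : Fin m × Fin n → ℝ => ∏ p, (s p).indicator (f p) (x p)) := by
    rw [volume_pi]
    exact Integrable.fintype_prod hgi
  rw [lintegral_congr hpt, ← ofReal_integral_eq_lintegral_ofReal hint
    (Eventually.of_forall fun x => Finset.prod_nonneg fun p _ => hg0 p _), volume_pi,
    integral_fintype_prod_eq_prod,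
    ENNReal.ofReal_prod_of_nonneg fun p _ => integral_nonneg (hg0 p)]
  refine Finset.prod_congr rfl fun p _ => ?_
  rw [ofReal_integral_eq_lintegral_ofReal (hgi p) (Eventually.of_forall (hg0 p))]
  have hd : expMeasure (r p.1.val * c p.2.val) =
    volume.withDensity (exponentialPDF (r p.1.val * c p.2.val)) := rfl
  rw [hd, withDensity_apply _ (hs p), ← lintegral_indicator (hs p)]
  refine lintegral_congr fun x => ?_
  by_cases hx : x ∈ s p
  · rw [Set.indicator_of_mem hx, Set.indicator_of_mem hx, hfe]
  · rw [Set.indicator_of_notMem hx, Set.indicator_of_notMem hx, ENNReal.ofReal_zero]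

theorem minAssign_eq_iInf (m n k : ℕ) (x : Fin m × Fin n → ℝ) :
    minAssign m n k x = ⨅ S : {S // IsAssignF m n k S}, ∑ p ∈ S.1, x p := by
  rw [minAssign, iInf]
  congr 1
  ext v
  simp [eq_comm]

theorem measurable_minAssign (m n k : ℕ) : Measurable (minAssign m n k) := by
  have : minAssign m n k = fun x => ⨅ S : {S // IsAssignF m n k S}, ∑ p ∈ S.1, x p :=
    funext (minAssign_eq_iInf m n k)
  rw [this]
  exact Measurable.iInf fun S => by fun_prop

theorem minAssign_le {m n k : ℕ} (x : Fin m × Fin n → ℝ) {S : Finset (Fin m × Fin n)}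
    (hS : IsAssignF m n k S) : minAssign m n k x ≤ ∑ p ∈ S, x p := by
  rw [minAssign_eq_iInf]
  exact ciInf_le (Set.finite_range _).bddBelow (⟨S, hS⟩ : {S // IsAssignF m n k S})

theorem exists_minAssign_eq {m n k : ℕ} (x : Fin m × Fin n → ℝ) (hkm : k ≤ m) (hkn : k ≤ n) :
    ∃ S, IsAssignF m n k S ∧ minAssign m n k x = ∑ p ∈ S, x p := by
  obtain ⟨S, hS, hc⟩ := exists_isMatching_card (ι := Fin m) (κ := Fin n) (t := k)
    (by simpa using hkm) (by simpa using hkn)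
  have : Nonempty {S // IsAssignF m n k S} := ⟨⟨S, hc, hS⟩⟩
  obtain ⟨T, hT⟩ := exists_eq_ciInf_of_finite
    (f := fun S : {S // IsAssignF m n k S} => ∑ p ∈ S.1, x p)
  exact ⟨T.1, T.2, by rw [minAssign_eq_iInf, ← hT]⟩

theorem minAssign_nonneg {m n k : ℕ} {x : Fin m × Fin n → ℝ} (hx : ∀ p, 0 ≤ x p) :
    0 ≤ minAssign m n k x := by
  rw [minAssign_eq_iInf]
  exact Real.iInf_nonneg fun S => Finset.sum_nonneg fun p _ => hx p

theorem minAssign_le_sum {m n k : ℕ} {x : Fin m × Fin n → ℝ} (hx : ∀ p, 0 ≤ x p)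
    (hkm : k ≤ m) (hkn : k ≤ n) : minAssign m n k x ≤ ∑ p, x p := by
  obtain ⟨S, hS, h⟩ := exists_minAssign_eq x hkm hkn
  rw [h]
  exact Finset.sum_le_univ_sum_of_nonneg hx

theorem integrable_minAssign {m n k : ℕ} {rate : Fin m × Fin n → ℝ} (hr : ∀ p, 0 < rate p)
    (hkm : k ≤ m) (hkn : k ≤ n) : Integrable (minAssign m n k) (expPi rate) := by
  have := isProbabilityMeasure_expPi hr
  refine ((memLp_two_expPi hr Finset.univ).integrable one_le_two).mono'
    (measurable_minAssign m n k).aestronglyMeasurable ?_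
  filter_upwards [ae_nonneg_expPi hr] with x hx
  rw [Real.norm_of_nonneg (minAssign_nonneg hx)]
  exact minAssign_le_sum hx hkm hkn

end Assignment

section Blocks

theorem IsMatching.map {ι κ ι' κ' : Type*} {e : ι × κ ↪ ι' × κ'}
    (h1 : ∀ p q, (e p).1 = (e q).1 → p.1 = q.1) (h2 : ∀ p q, (e p).2 = (e q).2 → p.2 = q.2)
    {T : Finset (ι × κ)} (hT : IsMatching T) : IsMatching (T.map e) := by
  intro p hp q hq hne
  obtain ⟨p, hpT, rfl⟩ := Finset.mem_map.1 hp
  obtain ⟨q, hqT, rfl⟩ := Finset.mem_map.1 hq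
  have h := hT p hpT q hqT fun h => hne (h ▸ rfl)
  exact ⟨fun h' => h.1 (h1 p q h'), fun h' => h.2 (h2 p q h')⟩

theorem IsMatching.preimage {ι κ ι' κ' : Type*} {e : ι × κ ↪ ι' × κ'}
    (h1 : ∀ p q, p.1 = q.1 → (e p).1 = (e q).1) (h2 : ∀ p q, p.2 = q.2 → (e p).2 = (e q).2)
    {S : Finset (ι' × κ')} (hS : IsMatching S) :
    IsMatching (S.preimage e e.injective.injOn) := by
  intro p hp q hq hne
  have h := hS (e p) (Finset.mem_preimage.1 hp) (e q) (Finset.mem_preimage.1 hq)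
    (e.injective.ne hne)
  exact ⟨fun h' => h.1 (h1 p q h'), fun h' => h.2 (h2 p q h')⟩

theorem IsMatching.union {ι κ : Type*} [DecidableEq ι] [DecidableEq κ] {A B : Finset (ι × κ)}
    (hA : IsMatching A) (hB : IsMatching B)
    (h : ∀ p ∈ A, ∀ q ∈ B, p.1 ≠ q.1 ∧ p.2 ≠ q.2) : IsMatching (A ∪ B) := by
  intro p hp q hq hne
  rcases Finset.mem_union.1 hp with hp | hp <;> rcases Finset.mem_union.1 hq with hq | hq
  · exact hA p hp q hq hne
  · exact h p hp q hq
  · exact ⟨(h q hq p hp).1.symm, (h q hq p hp).2.symm⟩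
  · exact hB p hp q hq hne

variable {l m n t k : ℕ}

/-- The first `l` rows of an `m × n` matrix. -/
def topEmb (n : ℕ) (h : l ≤ m) : Fin l × Fin n ↪ Fin m × Fin n :=
  ⟨fun p => (Fin.castLE h p.1, p.2), fun p q hpq => by
    simp only [Prod.mk.injEq, Fin.castLE_inj] at hpq
    exact Prod.ext hpq.1 hpq.2⟩

theorem mem_range_topEmb (h : l ≤ m) {q : Fin m × Fin n} :
    q ∈ Set.range (topEmb n h) ↔ q.1.val < l := by
  constructor
  · rintro ⟨p, rfl⟩
    exact p.1.2
  · intro hq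
    exact ⟨(⟨q.1, hq⟩, q.2), rfl⟩

/-- The increasing enumeration of the columns outside `K`. -/
def colEmb (K : Finset (Fin n)) : Fin (Finset.range n \ K.map Fin.valEmbedding).card ↪ Fin n :=
  ⟨fun j => ⟨(Finset.range n \ K.map Fin.valEmbedding).orderEmbOfFin rfl j,
      Finset.mem_range.1 (Finset.mem_sdiff.1 (Finset.orderEmbOfFin_mem _ rfl j)).1⟩,
    fun i j h => by
      simp only [Fin.mk.injEq] at h
      exact (Finset.orderEmbOfFin _ rfl).injective h⟩

theorem mem_range_colEmb {K : Finset (Fin n)} {j : Fin n} :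
    j ∈ Set.range (colEmb K) ↔ j ∉ K := by
  have h : (j : ℕ) ∈ Set.range ((Finset.range n \ K.map Fin.valEmbedding).orderEmbOfFin rfl) ↔
      j ∉ K := by
    rw [Finset.range_orderEmbOfFin]
    simp [Fin.val_inj]
  rw [← h]
  constructor
  · rintro ⟨i, rfl⟩
    exact ⟨i, rfl⟩
  · rintro ⟨i, hi⟩
    exact ⟨i, Fin.ext hi⟩

theorem card_range_sdiff_map (K : Finset (Fin n)) :
    (Finset.range n \ K.map Fin.valEmbedding).card = n - K.card := by
  rw [Finset.card_sdiff_of_subset, Finset.card_range, Finset.card_map]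
  intro j hj
  obtain ⟨i, _, rfl⟩ := Finset.mem_map.1 hj
  exact Finset.mem_range.2 i.2

/-- The rows of an `m × n` matrix after the first `l`, restricted to the columns outside `K`. -/
def botEmb (h : l ≤ m) (K : Finset (Fin n)) :
    Fin (m - l) × Fin (Finset.range n \ K.map Fin.valEmbedding).card ↪ Fin m × Fin n :=
  ⟨fun p => (⟨p.1 + l, by omega⟩, colEmb K p.2), fun p q hpq => by
    simp only [Prod.mk.injEq, Fin.mk.injEq, EmbeddingLike.apply_eq_iff_eq] at hpq
    exact Prod.ext (Fin.ext (by omega)) hpq.2⟩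

theorem botEmb_fst (h : l ≤ m) (K : Finset (Fin n))
    (p : Fin (m - l) × Fin (Finset.range n \ K.map Fin.valEmbedding).card) :
    ((botEmb h K p).1 : ℕ) = p.1 + l := rfl

theorem mem_range_botEmb (h : l ≤ m) {K : Finset (Fin n)} {q : Fin m × Fin n} :
    q ∈ Set.range (botEmb h K) ↔ ¬ q.1.val < l ∧ q.2 ∉ K := by
  constructor
  · rintro ⟨p, rfl⟩
    refine ⟨by simp [botEmb_fst], mem_range_colEmb.1 ⟨p.2, rfl⟩⟩
  · rintro ⟨h1, h2⟩
    obtain ⟨j, hj⟩ := mem_range_colEmb.2 h2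
    refine ⟨(⟨q.1 - l, by omega⟩, j), Prod.ext (Fin.ext ?_) hj⟩
    rw [botEmb_fst]
    exact Nat.sub_add_cancel (not_lt.1 h1)

/-- The total of the rows after the first `l`. -/
def botSum (l : ℕ) (x : Fin m × Fin n → ℝ) : ℝ := ∑ p with ¬ p.1.val < l, x p

/-- The first `l` rows of a matrix. -/
def topPart (h : l ≤ m) (x : Fin m × Fin n → ℝ) : Fin l × Fin n → ℝ := fun p => x (topEmb n h p)

/-- The optimal value of the rows after the first `l`, outside the columns `K`. -/
noncomputable def botMin (h : l ≤ m) (K : Finset (Fin n)) (x : Fin m × Fin n → ℝ) : ℝ :=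
  minAssign (m - l) (Finset.range n \ K.map Fin.valEmbedding).card (m - l)
    fun p => x (botEmb h K p)

variable {x : Fin m × Fin n → ℝ}

theorem botMin_nonneg (h : l ≤ m) (K : Finset (Fin n)) (hx : ∀ p, 0 ≤ x p) :
    0 ≤ botMin h K x := minAssign_nonneg fun _ => hx _

theorem botMin_le_botSum (h : l ≤ m) {K : Finset (Fin n)} (hx : ∀ p, 0 ≤ x p)
    (hK : m - l ≤ n - K.card) : botMin h K x ≤ botSum l x := by
  refine (minAssign_le_sum (fun _ => hx _) le_rfl (by rwa [card_range_sdiff_map])).trans ?_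
  rw [botSum, ← Finset.sum_map Finset.univ (botEmb h K) x]
  refine Finset.sum_le_sum_of_subset_of_nonneg ?_ fun p _ _ => hx p
  intro q hq
  obtain ⟨p, _, rfl⟩ := Finset.mem_map.1 hq
  exact Finset.mem_filter.2 ⟨Finset.mem_univ _, (mem_range_botEmb h).1 ⟨p, rfl⟩ |>.1⟩

theorem minAssign_le_add_botMin (h : l ≤ m) (hk : k = t + (m - l)) (hkm : k ≤ m) (hmn : m ≤ n)
    {T : Finset (Fin l × Fin n)} (hT : IsAssignF l n t T) :
    minAssign m n k x ≤ ∑ p ∈ T, topPart h x p + botMin h (cols T) x := by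
  have hT' : IsMatching T := hT.2
  obtain ⟨B, hB, hBe⟩ := exists_minAssign_eq (m := m - l)
    (n := (Finset.range n \ (cols T).map Fin.valEmbedding).card) (k := m - l)
    (fun p => x (botEmb h (cols T) p)) le_rfl (by
      rw [card_range_sdiff_map, hT'.card_cols, hT.1]; omega)
  have hcross : ∀ p ∈ T.map (topEmb n h), ∀ q ∈ B.map (botEmb h (cols T)),
      p.1 ≠ q.1 ∧ p.2 ≠ q.2 := by
    intro p hp q hq
    obtain ⟨p, hpT, rfl⟩ := Finset.mem_map.1 hp
    obtain ⟨q, hqT, rfl⟩ := Finset.mem_map.1 hq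
    have h1 := (mem_range_botEmb h).1 ⟨q, rfl⟩
    have h2 := (mem_range_topEmb h).1 ⟨p, rfl⟩
    refine ⟨fun h' => h1.1 (h' ▸ h2), fun h' => h1.2 ?_⟩
    rw [← h']
    exact Finset.mem_image_of_mem Prod.snd hpT
  have hdisj : Disjoint (T.map (topEmb n h)) (B.map (botEmb h (cols T))) :=
    Finset.disjoint_left.2 fun p hp hq => (hcross p hp p hq).1 rfl
  have hS : IsAssignF m n k (T.map (topEmb n h) ∪ B.map (botEmb h (cols T))) := by
    refine ⟨by rw [Finset.card_union_of_disjoint hdisj, Finset.card_map, Finset.card_map, hT.1,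
      hB.1, hk], ?_⟩
    refine IsMatching.union (hT'.map ?_ ?_) (IsMatching.map (T := B) ?_ ?_ hB.2) hcross
    · exact fun p q h' => Fin.castLE_injective h h'
    · exact fun p q h' => h'
    · intro p q h'
      have := congrArg Fin.val h'
      rw [botEmb_fst, botEmb_fst] at this
      exact Fin.ext (by omega)
    · exact fun p q h' => (colEmb _).injective h'
  refine (minAssign_le x hS).trans_eq ?_
  rw [Finset.sum_union hdisj, Finset.sum_map, Finset.sum_map, botMin, hBe]
  rfl

theorem sum_topPart_preimage (h : l ≤ m) (S : Finset (Fin m × Fin n)) :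
    ∑ p ∈ S.preimage (topEmb n h) (topEmb n h).injective.injOn, topPart h x p =
      ∑ p ∈ S with p.1.val < l, x p := by
  classical
  refine (Finset.sum_preimage' (topEmb n h) S _ x).trans ?_
  exact Finset.sum_congr (Finset.filter_congr fun q _ => mem_range_topEmb h) fun _ _ => rfl

theorem card_topPart_preimage (h : l ≤ m) (S : Finset (Fin m × Fin n)) :
    (S.preimage (topEmb n h) (topEmb n h).injective.injOn).card =
      (S.filter fun p => p.1.val < l).card := by
  have := sum_topPart_preimage (x := fun _ => 1) h S
  simp only [topPart, Finset.sum_const, nsmul_eq_mul, mul_one] at this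
  exact_mod_cast this

theorem card_filter_bot_le {S : Finset (Fin m × Fin n)} (hS : IsMatching S) :
    (S.filter fun p => ¬ p.1.val < l).card ≤ m - l := by
  rw [← (hS.mono (Finset.filter_subset _ _)).card_rows]
  calc _ ≤ ((Finset.univ : Finset (Fin m)).filter fun i => ¬ i.val < l).card := by
        refine Finset.card_le_card fun i hi => ?_
        obtain ⟨j, hj⟩ := mem_rows.1 hi
        exact Finset.mem_filter.2 ⟨Finset.mem_univ _, (Finset.mem_filter.1 hj).2⟩
    _ ≤ m - l := by
        rw [← Finset.card_map Fin.valEmbedding, ← Nat.card_Ico]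
        refine Finset.card_le_card fun i hi => ?_
        obtain ⟨j, hj, rfl⟩ := Finset.mem_map.1 hi
        have := (Finset.mem_filter.1 hj).2
        exact Finset.mem_Ico.2 ⟨not_lt.1 this, j.2⟩

theorem IsAssignF.le_card_topPart (h : l ≤ m) (hk : k = t + (m - l))
    {S : Finset (Fin m × Fin n)} (hS : IsAssignF m n k S) :
    t ≤ (S.preimage (topEmb n h) (topEmb n h).injective.injOn).card := by
  have h1 := card_filter_bot_le (l := l) hS.2
  have h2 := Finset.card_filter_add_card_filter_not (s := S) fun p => p.1.val < l
  rw [card_topPart_preimage]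
  have := hS.1
  omega

theorem IsAssignF.minAssign_le_topPart (h : l ≤ m) (hk : k = t + (m - l))
    (hx : ∀ p, 0 ≤ x p) {S : Finset (Fin m × Fin n)} (hS : IsAssignF m n k S) :
    minAssign l n t (topPart h x) ≤
      ∑ p ∈ S.preimage (topEmb n h) (topEmb n h).injective.injOn, topPart h x p := by
  obtain ⟨T, hT, hTc⟩ := Finset.exists_subset_card_eq (hS.le_card_topPart h hk)
  have hm : IsMatching (S.preimage (topEmb n h) (topEmb n h).injective.injOn) :=
    IsMatching.preimage (fun p q h' => congrArg (Fin.castLE h) h') (fun p q h' => h') hS.2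
  exact (minAssign_le _ ⟨hTc, hm.mono hT⟩).trans
    (Finset.sum_le_sum_of_subset_of_nonneg hT fun p _ _ => hx _)

theorem sum_topPart_preimage_le (h : l ≤ m) (hx : ∀ p, 0 ≤ x p) (S : Finset (Fin m × Fin n)) :
    ∑ p ∈ S.preimage (topEmb n h) (topEmb n h).injective.injOn, topPart h x p ≤
      ∑ p ∈ S, x p := by
  rw [sum_topPart_preimage]
  exact Finset.sum_le_sum_of_subset_of_nonneg (Finset.filter_subset _ _) fun p _ _ => hx p

theorem minAssign_topPart_le (h : l ≤ m) (hk : k = t + (m - l)) (hkm : k ≤ m) (hmn : m ≤ n)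
    (hx : ∀ p, 0 ≤ x p) : minAssign l n t (topPart h x) ≤ minAssign m n k x := by
  obtain ⟨S, hS, he⟩ := exists_minAssign_eq x hkm (hkm.trans hmn)
  rw [he]
  exact (hS.minAssign_le_topPart h hk hx).trans (sum_topPart_preimage_le h hx S)

theorem minAssign_le_add_botSum (h : l ≤ m) (hk : k = t + (m - l)) (hkm : k ≤ m) (hmn : m ≤ n)
    (hx : ∀ p, 0 ≤ x p) {T : Finset (Fin l × Fin n)} (hT : IsAssignF l n t T) :
    minAssign m n k x ≤ ∑ p ∈ T, topPart h x p + botSum l x := by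
  refine (minAssign_le_add_botMin h hk hkm hmn hT).trans ?_
  gcongr
  refine botMin_le_botSum h hx ?_
  rw [IsMatching.card_cols hT.2, hT.1]; omega

/-- Two distinct sets of positions in the first `l` rows have totals which differ by at most
the total of the remaining rows. -/
def CloseSums (h : l ≤ m) (x : Fin m × Fin n → ℝ) : Prop :=
  ∃ S S' : Finset (Fin l × Fin n), S ≠ S' ∧
    |∑ p ∈ S, topPart h x p - ∑ p ∈ S', topPart h x p| ≤ botSum l x

theorem botSum_nonneg (hx : ∀ p, 0 ≤ x p) : 0 ≤ botSum l x :=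
  Finset.sum_nonneg fun p _ => hx p

/-- When the first `l` rows dominate, the optimal assignment extends the optimal assignment of
the first `l` rows. -/
theorem exists_bestCols_of_not_closeSums (h : l ≤ m) (hk : k = t + (m - l)) (hkm : k ≤ m)
    (hmn : m ≤ n) (hx : ∀ p, 0 ≤ x p) (hc : ¬ CloseSums h x) :
    ∃ K, BestCols (topPart h x) t K ∧
      minAssign m n k x - minAssign l n t (topPart h x) = botMin h K x := by
  obtain ⟨T, hT, hTe⟩ := exists_minAssign_eq (topPart h x) (k := t) (by omega) (by omega)
  have hT' : IsMatching T := hT.2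
  refine ⟨cols T, ⟨T, ⟨⟨hT', hT.1, card_cols_sdiff_univ_le _⟩, ?_⟩, rfl⟩, ?_⟩
  · intro S' h1 h2 _ hne
    have h3 := minAssign_le (topPart h x) (S := S') ⟨h2, h1⟩
    rw [hTe] at h3
    refine lt_of_le_of_ne h3 fun he => hc ⟨S', T, hne, ?_⟩
    rw [he, sub_self, abs_zero]
    exact botSum_nonneg hx
  · obtain ⟨S, hS, hSe⟩ := exists_minAssign_eq x hkm (hkm.trans hmn)
    set U := S.preimage (topEmb n h) (topEmb n h).injective.injOn with hU
    have hUT : U = T := by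
      by_contra hne
      refine hc ⟨U, T, hne, ?_⟩
      have h1 := hS.minAssign_le_topPart h hk hx
      have h2 := sum_topPart_preimage_le h hx S
      have h3 := minAssign_le_add_botSum h hk hkm hmn hx hT
      rw [abs_of_nonneg] <;> linarith
    refine le_antisymm ?_ ?_
    · have := minAssign_le_add_botMin (x := x) h hk hkm hmn hT
      linarith
    · classical
      have hsplit := Finset.sum_filter_add_sum_filter_not S (fun p => p.1.val < l) x
      rw [← sum_topPart_preimage h S, ← hU, hUT] at hsplit
      have hbot : ∀ f : Fin m × Fin n → ℝ,
          ∑ p ∈ S.preimage (botEmb h (cols T)) (botEmb h (cols T)).injective.injOn,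
            f (botEmb h (cols T) p) = ∑ p ∈ S with ¬ p.1.val < l, f p := by
        intro f
        rw [Finset.sum_preimage' (botEmb h (cols T)) S _ f]
        refine Finset.sum_congr (Finset.filter_congr fun q hq => ?_) fun _ _ => rfl
        rw [mem_range_botEmb]
        refine and_iff_left_of_imp fun hql hqc => ?_
        obtain ⟨i, hi⟩ := mem_cols.1 hqc
        rw [← hUT, hU, Finset.mem_preimage] at hi
        have := IsMatching.eq_of_snd hS.2 hi hq rfl
        apply hql
        rw [← this]
        exact i.2
      have hcard : (S.preimage (botEmb h (cols T)) (botEmb h (cols T)).injective.injOn).card =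
          m - l := by
        have h1 := hbot fun _ => 1
        simp only [Finset.sum_const, nsmul_eq_mul, mul_one] at h1
        have h2 := Finset.card_filter_add_card_filter_not (s := S) fun p => p.1.val < l
        have h3 := card_topPart_preimage h S
        rw [← hU, hUT, hT.1] at h3
        have h4 := hS.1
        have h5 : (S.preimage (botEmb h (cols T)) (botEmb h (cols T)).injective.injOn).card =
          (S.filter fun p => ¬ p.1.val < l).card := by exact_mod_cast h1
        omega
      have hmin := minAssign_le (m := m - l)
        (n := (Finset.range n \ (cols T).map Fin.valEmbedding).card) (k := m - l)
        (fun p => x (botEmb h (cols T) p)) ⟨hcard, IsMatching.preimage (fun p q h' => by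
          rw [Fin.ext_iff, botEmb_fst, botEmb_fst, h']) (fun p q h' =>
          congrArg (colEmb (cols T)) h') hS.2⟩
      rw [hbot x] at hmin
      rw [botMin, hSe, hTe]
      linarith

/-- The optimal value of the remaining rows outside the columns used by the optimal assignment
of the first `l` rows. -/
noncomputable def residualMin (h : l ≤ m) (t : ℕ) (x : Fin m × Fin n → ℝ) : ℝ :=
  ∑ K : Finset (Fin n), Set.indicator {x | BestCols (topPart h x) t K} (botMin h K) x

theorem residualMin_eq (h : l ≤ m) {K : Finset (Fin n)} (hK : BestCols (topPart h x) t K) :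
    residualMin h t x = botMin h K x := by
  rw [residualMin, Finset.sum_eq_single K]
  · exact Set.indicator_of_mem (show x ∈ {x | BestCols (topPart h x) t K} from hK) _
  · intro K' _ hne
    exact Set.indicator_of_notMem (fun hK' => hne (hK'.unique hK)) _
  · simp

theorem abs_sub_residualMin_le (h : l ≤ m) (hk : k = t + (m - l)) (hkm : k ≤ m)
    (hmn : m ≤ n) (hx : ∀ p, 0 ≤ x p) :
    |minAssign m n k x - minAssign l n t (topPart h x) - residualMin h t x| ≤
      Set.indicator {x | CloseSums h x} (botSum l) x := by
  by_cases hc : CloseSums h x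
  · rw [Set.indicator_of_mem (show x ∈ {x | CloseSums h x} from hc)]
    have hb := botSum_nonneg (l := l) hx
    have h0 : 0 ≤ residualMin h t x ∧ residualMin h t x ≤ botSum l x := by
      by_cases hK : ∃ K, BestCols (topPart h x) t K
      · obtain ⟨K, hK⟩ := hK
        rw [residualMin_eq h hK]
        exact ⟨botMin_nonneg h K hx, botMin_le_botSum h hx (by rw [hK.card_eq]; omega)⟩
      · have : residualMin h t x = 0 := Finset.sum_eq_zero fun K _ =>
          Set.indicator_of_notMem (show x ∉ {x | BestCols (topPart h x) t K} from
            fun hK' => hK ⟨K, hK'⟩) _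
        rw [this]
        exact ⟨le_rfl, hb⟩
    have h1 := minAssign_topPart_le h hk hkm hmn hx
    obtain ⟨T, hT, hTe⟩ := exists_minAssign_eq (topPart h x) (k := t) (by omega) (by omega)
    have h2 := minAssign_le_add_botSum h hk hkm hmn hx hT
    rw [abs_le]
    constructor <;> linarith [h0.1, h0.2]
  · rw [Set.indicator_of_notMem (show x ∉ {x | CloseSums h x} from hc)]
    obtain ⟨K, hK, he⟩ := exists_bestCols_of_not_closeSums h hk hkm hmn hx hc
    rw [residualMin_eq h hK, he, sub_self, abs_zero]

end Blocks

section Limit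

open ProbabilityTheory

variable {k l m n t : ℕ} {a b c : ℕ → ℝ}

theorem Emin_eq_integral (ha : ∀ i < m, 0 < a i) (hc : ∀ j < n, 0 < c j) :
    Emin k m n a c =
      ∫ x, minAssign m n k x ∂expPi fun p : Fin m × Fin n => a p.1 * c p.2 := by
  rw [Emin, rankOneMeasure_eq_expPi ha hc]

theorem measurable_topPart (h : l ≤ m) :
    Measurable (topPart h : (Fin m × Fin n → ℝ) → Fin l × Fin n → ℝ) := by
  unfold topPart
  fun_prop

theorem measurable_botMin (h : l ≤ m) (K : Finset (Fin n)) : Measurable (botMin h K) := by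
  unfold botMin
  exact (measurable_minAssign _ _ _).comp (by fun_prop)

theorem measurable_botSum : Measurable (botSum l : (Fin m × Fin n → ℝ) → ℝ) := by
  unfold botSum
  fun_prop

theorem measurePreserving_topPart (h : l ≤ m) (ha : ∀ i < m, 0 < a i) (hc : ∀ j < n, 0 < c j) :
    MeasurePreserving (topPart h) (expPi fun p : Fin m × Fin n => a p.1 * c p.2)
      (expPi fun p : Fin l × Fin n => a p.1 * c p.2) :=
  measurePreserving_comp_expPi (fun p => mul_pos (ha _ p.1.2) (hc _ p.2.2))
    (topEmb n h).injective

theorem Emin_eq_integral_topPart (h : l ≤ m) (ha : ∀ i < m, 0 < a i) (hc : ∀ j < n, 0 < c j) :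
    Emin t l n a c = ∫ x, minAssign l n t (topPart h x)
      ∂expPi fun p : Fin m × Fin n => a p.1 * c p.2 := by
  rw [Emin_eq_integral (fun i hi => ha i (hi.trans_le h)) hc,
    ← (measurePreserving_topPart h ha hc).map_eq]
  exact integral_map (measurable_topPart h).aemeasurable
    (measurable_minAssign l n t).aestronglyMeasurable

theorem integral_botMin (h : l ≤ m) (K : Finset (Fin n)) (ha : ∀ i < m, 0 < a i)
    (hc : ∀ j < n, 0 < c j) :
    ∫ x, botMin h K x ∂expPi (fun p : Fin m × Fin n => a p.1 * c p.2) =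
      Emin (m - l) (m - l) (Finset.range n \ K.map Fin.valEmbedding).card
        (fun i => a (i + l))
        (fun j => if h : j < (Finset.range n \ K.map Fin.valEmbedding).card then
            c ((Finset.range n \ K.map Fin.valEmbedding).orderEmbOfFin rfl ⟨j, h⟩)
          else 0) := by
  have hp : ∀ p : Fin m × Fin n, 0 < a p.1 * c p.2 := fun p => mul_pos (ha _ p.1.2) (hc _ p.2.2)
  rw [Emin_eq_integral (fun i hi => ha _ (by omega)) (fun j hj => ?_)]
  · have hm := measurePreserving_comp_expPi hp (botEmb h K).injective
    have he : (expPi fun p : Fin (m - l) × Fin (Finset.range n \ K.map Fin.valEmbedding).card =>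
        a (p.1 + l) * (if h : (p.2 : ℕ) < (Finset.range n \ K.map Fin.valEmbedding).card then
            c ((Finset.range n \ K.map Fin.valEmbedding).orderEmbOfFin rfl ⟨p.2, h⟩)
          else 0)) = expPi fun p => a (botEmb h K p).1 * c (botEmb h K p).2 := by
      congr 1
      funext p
      rw [dif_pos p.2.2]
      rfl
    rw [he, ← hm.map_eq]
    exact (integral_map hm.measurable.aemeasurable (measurable_minAssign _ _ _).aestronglyMeasurable).symm
  · rw [dif_pos hj]
    exact hc _ (colEmb K ⟨j, hj⟩).2

theorem integrable_botMin (h : l ≤ m) {K : Finset (Fin n)} (hK : m - l ≤ n - K.card)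
    (ha : ∀ i < m, 0 < a i) (hc : ∀ j < n, 0 < c j) :
    Integrable (botMin h K) (expPi fun p : Fin m × Fin n => a p.1 * c p.2) := by
  have hp : ∀ p : Fin m × Fin n, 0 < a p.1 * c p.2 := fun p => mul_pos (ha _ p.1.2) (hc _ p.2.2)
  have hm := measurePreserving_comp_expPi hp (botEmb h K).injective
  exact hm.integrable_comp_of_integrable
    (integrable_minAssign (fun p => hp (botEmb h K p)) le_rfl (by rwa [card_range_sdiff_map]))

theorem measurableSet_bestCols_topPart (h : l ≤ m) (K : Finset (Fin n)) :
    MeasurableSet {x : Fin m × Fin n → ℝ | BestCols (topPart h x) t K} :=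
  measurable_topPart h (measurableSet_bestCols t K)

theorem bestCols_topPart_eq_empty (h : l ≤ m) {K : Finset (Fin n)} (hK : K.card ≠ t) :
    {x : Fin m × Fin n → ℝ | BestCols (topPart h x) t K} = ∅ :=
  Set.eq_empty_of_forall_notMem fun _ hx => hK (BestCols.card_eq hx)

theorem integrable_indicator_botMin (h : l ≤ m) (ht : t + (m - l) ≤ n) (K : Finset (Fin n))
    (ha : ∀ i < m, 0 < a i) (hc : ∀ j < n, 0 < c j) :
    Integrable (Set.indicator {x | BestCols (topPart h x) t K} (botMin h K))
      (expPi fun p : Fin m × Fin n => a p.1 * c p.2) := by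
  by_cases hK : K.card = t
  · exact (integrable_botMin h (by omega) ha hc).indicator (measurableSet_bestCols_topPart h K)
  · rw [bestCols_topPart_eq_empty h hK, Set.indicator_empty]
    exact integrable_zero _ _ _

theorem integral_indicator_botMin (h : l ≤ m) (htl : t ≤ l) (htn : t ≤ n) {K : Finset (Fin n)}
    (hK : K.card = t) (ha : ∀ i < m, 0 < a i) (hc : ∀ j < n, 0 < c j) :
    ∫ x, Set.indicator {x | BestCols (topPart h x) t K} (botMin h K) x
        ∂expPi (fun p : Fin m × Fin n => a p.1 * c p.2) =
      prSetN c n (K.map Fin.valEmbedding) *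
        ∫ x, botMin h K x ∂expPi (fun p : Fin m × Fin n => a p.1 * c p.2) := by
  have hp : ∀ p : Fin m × Fin n, 0 < a p.1 * c p.2 := fun p => mul_pos (ha _ p.1.2) (hc _ p.2.2)
  set μ := expPi fun p : Fin m × Fin n => a p.1 * c p.2 with hμ
  have hB := measurableSet_bestCols (ι := Fin l) t K
  have hi : IndepFun (topPart h) (fun x p => x (botEmb h K p)) μ :=
    indepFun_comp_expPi hp fun p q hpq => by
      have h1 := (mem_range_topEmb (n := n) h).1 ⟨p, hpq⟩
      have h2 := (mem_range_botEmb h (K := K)).1 ⟨q, rfl⟩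
      exact h2.1 h1
  have hi' : IndepFun
      (fun x => Set.indicator {y | BestCols y t K} (1 : (Fin l × Fin n → ℝ) → ℝ) (topPart h x))
      (botMin h K) μ :=
    hi.comp (measurable_one.indicator hB) (measurable_minAssign _ _ _)
  have h1 : ∫ x, Set.indicator {y | BestCols y t K} (1 : (Fin l × Fin n → ℝ) → ℝ)
      (topPart h x) ∂μ = prSetN c n (K.map Fin.valEmbedding) := by
    rw [← measureReal_bestCols (ι := Fin l) (a := fun i => a i)
      (fun i => ha _ (i.2.trans_le h)) hc (by simpa using htl) htn K hK,
      ← integral_indicator_one hB, ← (measurePreserving_topPart h ha hc).map_eq]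
    exact (integral_map (measurable_topPart h).aemeasurable
      (measurable_one.indicator hB).aestronglyMeasurable).symm
  rw [← h1, ← hi'.integral_fun_mul_eq_mul_integral
    (((measurable_one.indicator hB).comp (measurable_topPart h)).aestronglyMeasurable)
    (measurable_botMin h K).aestronglyMeasurable]
  refine integral_congr_ae (Eventually.of_forall fun x => ?_)
  by_cases hx : BestCols (topPart h x) t K <;> simp [Set.indicator, hx]

theorem integrable_residualMin (h : l ≤ m) (ht : t + (m - l) ≤ n)
    (ha : ∀ i < m, 0 < a i) (hc : ∀ j < n, 0 < c j) :
    Integrable (residualMin h t) (expPi fun p : Fin m × Fin n => a p.1 * c p.2) :=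
  integrable_finsetSum _ fun K _ => integrable_indicator_botMin h ht K ha hc

theorem integral_residualMin (h : l ≤ m) (htl : t ≤ l) (ht : t + (m - l) ≤ n)
    (ha : ∀ i < m, 0 < a i) (hc : ∀ j < n, 0 < c j) :
    ∫ x, residualMin h t x ∂expPi (fun p : Fin m × Fin n => a p.1 * c p.2) =
      ∑ K : Finset (Fin n), if K.card = t then
        prSetN c n (K.map Fin.valEmbedding) *
          Emin (m - l) (m - l) (Finset.range n \ K.map Fin.valEmbedding).card
            (fun i => a (i + l))
            (fun j => if h : j < (Finset.range n \ K.map Fin.valEmbedding).card then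
                c ((Finset.range n \ K.map Fin.valEmbedding).orderEmbOfFin rfl ⟨j, h⟩)
              else 0)
      else 0 := by
  unfold residualMin
  rw [integral_finsetSum _ fun K _ => integrable_indicator_botMin h ht K ha hc]
  refine Finset.sum_congr rfl fun K _ => ?_
  split_ifs with hK
  · rw [integral_indicator_botMin h htl (by omega) hK ha hc, integral_botMin h K ha hc]
  · rw [bestCols_topPart_eq_empty h hK, Set.indicator_empty]
    simp

theorem lintegral_botSum_congr (ha : ∀ i < m, 0 < a i) (hb : ∀ i < m, 0 < b i)
    (hc : ∀ j < n, 0 < c j) (hab : ∀ i, l ≤ i → a i = b i) {f : ℝ → ENNReal} (hf : Measurable f) :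
    ∫⁻ x, f (botSum l x) ∂expPi (fun p : Fin m × Fin n => a p.1 * c p.2) =
      ∫⁻ x, f (botSum l x) ∂expPi (fun p : Fin m × Fin n => b p.1 * c p.2) := by
  have hs : ∀ x : Fin m × Fin n → ℝ,
      botSum l x = ∑ p : {p : Fin m × Fin n // ¬ p.1.val < l}, x p.1 := fun x =>
    Finset.sum_subtype _ (by simp) _
  have key : ∀ a : ℕ → ℝ, (∀ i < m, 0 < a i) →
      ∫⁻ x, f (botSum l x) ∂expPi (fun p : Fin m × Fin n => a p.1 * c p.2) =
        ∫⁻ y, f (∑ p, y p) ∂expPi fun p : {p : Fin m × Fin n // ¬ p.1.val < l} =>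
          a p.1.1 * c p.1.2 := by
    intro a ha
    have hm := measurePreserving_comp_expPi (rate := fun p : Fin m × Fin n => a p.1 * c p.2)
      (fun p => mul_pos (ha _ p.1.2) (hc _ p.2.2))
      (Subtype.val_injective (p := fun p : Fin m × Fin n => ¬ p.1.val < l))
    simp_rw [hs]
    exact hm.lintegral_comp (f := fun y => f (∑ p, y p)) (by fun_prop)
  rw [key a ha, key b hb]
  congr 2
  funext p
  rw [hab _ (not_lt.1 p.2)]

theorem lintegral_botSum_sq_lt_top (ha : ∀ i < m, 0 < a i) (hc : ∀ j < n, 0 < c j) :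
    ∫⁻ x, ENNReal.ofReal (botSum l x) * ENNReal.ofReal (2 * botSum l x)
      ∂expPi (fun p : Fin m × Fin n => a p.1 * c p.2) < ⊤ := by
  have hp : ∀ p : Fin m × Fin n, 0 < a p.1 * c p.2 := fun p => mul_pos (ha _ p.1.2) (hc _ p.2.2)
  have h2 := ((memLp_two_expPi hp {p | ¬ p.1.val < l}).integrable_sq.const_mul 2).lintegral_lt_top
  refine (lintegral_congr_ae ?_).trans_lt h2
  filter_upwards [ae_nonneg_expPi hp] with x hx
  simp only [botSum]
  rw [← ENNReal.ofReal_mul (Finset.sum_nonneg fun p _ => hx p)]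
  congr 1
  ring

theorem lintegral_closeSums_le (h : l ≤ m) (ha : ∀ i < m, 0 < a i) (hc : ∀ j < n, 0 < c j)
    {Λ : ℝ} (hΛ : ∀ i < l, ∀ j < n, a i * c j ≤ Λ) :
    ∫⁻ x, ENNReal.ofReal (Set.indicator {x | CloseSums h x} (botSum l) x)
        ∂expPi (fun p : Fin m × Fin n => a p.1 * c p.2) ≤
      Fintype.card (Finset (Fin l × Fin n) × Finset (Fin l × Fin n)) * (ENNReal.ofReal Λ *
        ∫⁻ x, ENNReal.ofReal (botSum l x) * ENNReal.ofReal (2 * botSum l x)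
          ∂expPi (fun p : Fin m × Fin n => a p.1 * c p.2)) := by
  have hp : ∀ p : Fin m × Fin n, 0 < a p.1 * c p.2 := fun p => mul_pos (ha _ p.1.2) (hc _ p.2.2)
  set μ := expPi fun p : Fin m × Fin n => a p.1 * c p.2 with hμ
  set close : Finset (Fin l × Fin n) → Finset (Fin l × Fin n) → Set (Fin m × Fin n → ℝ) :=
    fun S S' => {x | |∑ q ∈ S, topPart h x q - ∑ q ∈ S', topPart h x q| ≤ botSum l x} with hcl
  have hcm : ∀ S S', MeasurableSet (close S S') := fun S S' => by
    have := measurable_topPart (n := n) h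
    exact measurableSet_le (by fun_prop) measurable_botSum
  have hbm : Measurable (botSum l : (Fin m × Fin n → ℝ) → ℝ) := measurable_botSum
  have hup : ∀ (p : Fin l × Fin n) (x : Fin m × Fin n → ℝ) s,
      botSum l (Function.update x (topEmb n h p) s) = botSum l x := fun p x s => by
    refine Finset.sum_congr rfl fun q hq => Function.update_of_ne ?_ _ _
    rintro rfl
    exact (Finset.mem_filter.1 hq).2 ((mem_range_topEmb h).1 ⟨p, rfl⟩)
  have hone : ∀ S S', (∃ p ∈ S, p ∉ S') →
      ∫⁻ x, ENNReal.ofReal (botSum l x) * (close S S').indicator 1 x ∂μ ≤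
        ENNReal.ofReal Λ *
          ∫⁻ x, ENNReal.ofReal (botSum l x) * ENNReal.ofReal (2 * botSum l x) ∂μ := by
    rintro S S' ⟨p, hpS, hpS'⟩
    have hg := lintegral_gap_le hp (S := S.map (topEmb n h)) (S' := S'.map (topEmb n h))
      (p := topEmb n h p) (φ := fun x => ENNReal.ofReal (botSum l x)) (g := botSum l)
      (Finset.mem_map_of_mem _ hpS) (by simpa using hpS') hbm.ennreal_ofReal hbm
      (fun x s => by rw [hup]) (hup p)
    simp only [Finset.sum_map] at hg
    refine hg.trans ?_
    rw [← lintegral_const_mul _ (by fun_prop)]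
    refine lintegral_mono fun x => ?_
    rw [mul_left_comm]
    gcongr
    exact hΛ _ p.1.2 _ p.2.2
  have hpair : ∀ q : Finset (Fin l × Fin n) × Finset (Fin l × Fin n), q.1 ≠ q.2 →
      ∫⁻ x, ENNReal.ofReal (botSum l x) * (close q.1 q.2).indicator 1 x ∂μ ≤
        ENNReal.ofReal Λ *
          ∫⁻ x, ENNReal.ofReal (botSum l x) * ENNReal.ofReal (2 * botSum l x) ∂μ := by
    rintro ⟨S, S'⟩ hne
    by_cases hsub : S ⊆ S'
    · have hsub' : ¬ S' ⊆ S := fun h' => hne (Finset.Subset.antisymm hsub h')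
      have hcs : close S S' = close S' S := by
        ext x
        simp only [hcl, Set.mem_ofPred_eq, abs_sub_comm]
      rw [hcs]
      exact hone S' S (Finset.not_subset.1 hsub')
    · exact hone S S' (Finset.not_subset.1 hsub)
  calc ∫⁻ x, ENNReal.ofReal (Set.indicator {x | CloseSums h x} (botSum l) x) ∂μ
      ≤ ∫⁻ x, ∑ q : Finset (Fin l × Fin n) × Finset (Fin l × Fin n), if q.1 ≠ q.2 then
          ENNReal.ofReal (botSum l x) * (close q.1 q.2).indicator 1 x else 0 ∂μ := by
        refine lintegral_mono fun x => ?_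
        by_cases hx : CloseSums h x
        · obtain ⟨S, S', hne, hle⟩ := id hx
          have hmem : x ∈ close S S' := hle
          rw [Set.indicator_of_mem (show x ∈ {x | CloseSums h x} from hx)]
          refine le_trans (le_of_eq ?_) (Finset.single_le_sum (fun _ _ => zero_le)
            (Finset.mem_univ (S, S')))
          rw [if_pos hne, Set.indicator_of_mem hmem, Pi.one_apply, mul_one]
        · rw [Set.indicator_of_notMem (show x ∉ {x | CloseSums h x} from hx)]
          simp
    _ = ∑ q : Finset (Fin l × Fin n) × Finset (Fin l × Fin n), ∫⁻ x, if q.1 ≠ q.2 then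
          ENNReal.ofReal (botSum l x) * (close q.1 q.2).indicator 1 x else 0 ∂μ := by
        refine lintegral_finsetSum _ fun q _ => ?_
        split_ifs
        · exact hbm.ennreal_ofReal.mul (measurable_one.indicator (hcm _ _))
        · exact measurable_const
    _ ≤ ∑ q : Finset (Fin l × Fin n) × Finset (Fin l × Fin n), ENNReal.ofReal Λ *
          ∫⁻ x, ENNReal.ofReal (botSum l x) * ENNReal.ofReal (2 * botSum l x) ∂μ := by
        refine Finset.sum_le_sum fun q _ => ?_
        split_ifs with hq
        · exact hpair q hq
        · simp
    _ = _ := by rw [Finset.sum_const, Finset.card_univ, nsmul_eq_mul]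

theorem abs_Emin_sub_le (h : l ≤ m) (hk : k = t + (m - l)) (hkm : k ≤ m) (hmn : m ≤ n)
    (ha : ∀ i < m, 0 < a i) (hc : ∀ j < n, 0 < c j)
    {Λ : ℝ} (hΛ0 : 0 ≤ Λ) (hΛ : ∀ i < l, ∀ j < n, a i * c j ≤ Λ) :
    |Emin k m n a c - Emin t l n a c -
        ∫ x, residualMin h t x ∂expPi (fun p : Fin m × Fin n => a p.1 * c p.2)| ≤
      Fintype.card (Finset (Fin l × Fin n) × Finset (Fin l × Fin n)) * (Λ *
        (∫⁻ x, ENNReal.ofReal (botSum l x) * ENNReal.ofReal (2 * botSum l x)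
          ∂expPi (fun p : Fin m × Fin n => a p.1 * c p.2)).toReal) := by
  have hp : ∀ p : Fin m × Fin n, 0 < a p.1 * c p.2 := fun p => mul_pos (ha _ p.1.2) (hc _ p.2.2)
  have hM := lintegral_botSum_sq_lt_top (l := l) ha hc
  have hC := lintegral_closeSums_le h ha hc hΛ
  rw [Emin_eq_integral ha hc, Emin_eq_integral_topPart h ha hc]
  set μ := expPi fun p : Fin m × Fin n => a p.1 * c p.2 with hμ
  have hi1 : Integrable (minAssign m n k) μ := integrable_minAssign hp hkm (hkm.trans hmn)
  have hi2 : Integrable (fun x => minAssign l n t (topPart h x)) μ :=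
    (measurePreserving_topPart h ha hc).integrable_comp_of_integrable
      (integrable_minAssign (fun p => hp (topEmb n h p)) (by omega) (by omega))
  have hi3 : Integrable (residualMin h t) μ := integrable_residualMin h (by omega) ha hc
  rw [← integral_sub hi1 hi2, ← integral_sub (by exact hi1.sub hi2) hi3, ← Real.norm_eq_abs,
    ← toReal_enorm]
  refine (ENNReal.toReal_mono ?_ ((enorm_integral_le_lintegral_enorm _).trans
    ((lintegral_mono_ae ?_).trans hC))).trans (le_of_eq ?_)
  · exact ENNReal.mul_ne_top (ENNReal.natCast_ne_top _)
      (ENNReal.mul_ne_top ENNReal.ofReal_ne_top hM.ne)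
  · filter_upwards [ae_nonneg_expPi hp] with x hx
    rw [Real.enorm_eq_ofReal_abs]
    exact ENNReal.ofReal_le_ofReal (abs_sub_residualMin_le h hk hkm hmn hx)
  · rw [ENNReal.toReal_mul, ENNReal.toReal_mul, ENNReal.toReal_ofReal hΛ0, ENNReal.toReal_natCast]

theorem sum_powerset_range {M : Type*} [AddCommMonoid M] (n : ℕ) (f : Finset ℕ → M) :
    ∑ K ∈ (Finset.range n).powerset, f K =
      ∑ K : Finset (Fin n), f (K.map Fin.valEmbedding) := by
  have h : (Finset.range n).powerset =
      Finset.univ.map (Finset.mapEmbedding (Fin.valEmbedding (n := n))).toEmbedding := by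
    ext K
    simp only [Finset.mem_powerset, Finset.mem_map, Finset.mem_univ, true_and]
    constructor
    · intro hK
      refine ⟨K.attachFin fun j hj => Finset.mem_range.1 (hK hj), ?_⟩
      exact Finset.map_valEmbedding_attachFin _
    · rintro ⟨L, rfl⟩ j hj
      obtain ⟨i, _, rfl⟩ := Finset.mem_map.1 hj
      exact Finset.mem_range.2 i.2
  rw [h, Finset.sum_map]
  rfl

end Limit

/-- If `k > m − l > 0`, the limit of `E(k, r₁,…,r_m, c) − E(k+l−m, r₁,…,r_l, c)` as the
first `l` rates `r₁,…,r_l` tend to `0` from above is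
`∑_{K ⊆ [n], |K| = k+l−m} Pr(c,K) · E(m−l, r_{l+1},…,r_m, c'(K))`, where `c'(K)` is the
tuple of the `c_j` with `j ∉ K`. -/
theorem Emin_limit_large_k (k m n l : ℕ) (hk : 0 < k) (hkm : k ≤ m) (hmn : m ≤ n)
    (hl : 0 < l) (hlm : l ≤ m) (h₁ : m - l < k) (h₂ : 0 < m - l)
    (r c : ℕ → ℝ) (hr : ∀ i < m, 0 < r i) (hc : ∀ j < n, 0 < c j) :
    Tendsto
      (fun ρ : Fin l → ℝ =>
        Emin k m n (fun i => if h : i < l then ρ ⟨i, h⟩ else r i) c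
          - Emin (k + l - m) l n (fun i => if h : i < l then ρ ⟨i, h⟩ else r i) c)
      (nhdsWithin 0 {ρ | ∀ i, 0 < ρ i})
      (nhds (∑ K ∈ (Finset.range n).powerset,
        if K.card = k + l - m then
          prSetN c n K *
            Emin (m - l) (m - l) ((Finset.range n \ K).card) (fun i => r (i + l))
              (fun j => if h : j < (Finset.range n \ K).card then
                  c ((Finset.range n \ K).orderEmbOfFin rfl ⟨j, h⟩)
                else 0)
        else 0)) := by
  set t := k + l - m with ht
  have hkt : k = t + (m - l) := by omega
  set a : (Fin l → ℝ) → ℕ → ℝ := fun ρ i => if h : i < l then ρ ⟨i, h⟩ else r i with ha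
  have hapos : ∀ ρ : Fin l → ℝ, (∀ i, 0 < ρ i) → ∀ i < m, 0 < a ρ i := by
    intro ρ hρ i hi
    simp only [ha]
    split_ifs
    exacts [hρ _, hr i hi]
  have hshift : ∀ ρ, (fun i => a ρ (i + l)) = fun i => r (i + l) := fun ρ => by
    funext i
    simp [ha]
  have hΛ : ∀ ρ : Fin l → ℝ, (∀ i, 0 < ρ i) → ∀ i < l, ∀ j < n,
      a ρ i * c j ≤ (∑ i, ρ i) * ∑ j ∈ Finset.range n, c j := by
    intro ρ hρ i hi j hj
    have h1 : a ρ i ≤ ∑ i, ρ i := by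
      simp only [ha, dif_pos hi]
      exact Finset.single_le_sum (fun i _ => (hρ i).le) (Finset.mem_univ (⟨i, hi⟩ : Fin l))
    have h2 : c j ≤ ∑ j ∈ Finset.range n, c j :=
      Finset.single_le_sum (fun j hj => (hc j (Finset.mem_range.1 hj)).le)
        (Finset.mem_range.2 hj)
    exact mul_le_mul h1 h2 (hc j hj).le (Finset.sum_nonneg fun i _ => (hρ i).le)
  set M := (∫⁻ x, ENNReal.ofReal (botSum l x) * ENNReal.ofReal (2 * botSum l x)
    ∂expPi (fun p : Fin m × Fin n => r p.1 * c p.2)).toReal with hM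
  set N : ℝ := ((Fintype.card (Finset (Fin l × Fin n) × Finset (Fin l × Fin n)) : ℕ) : ℝ)
  rw [sum_powerset_range]
  simp only [Finset.card_map]
  rw [tendsto_iff_dist_tendsto_zero]
  refine squeeze_zero' (g := fun ρ : Fin l → ℝ =>
    N * (((∑ i, ρ i) * ∑ j ∈ Finset.range n, c j) * M))
    (Eventually.of_forall fun _ => dist_nonneg) ?_ ?_
  · filter_upwards [self_mem_nhdsWithin] with ρ hρ
    have hle := abs_Emin_sub_le (a := a ρ) hlm hkt hkm hmn (hapos ρ hρ) hc
      (mul_nonneg (Finset.sum_nonneg fun i _ => (hρ i).le)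
        (Finset.sum_nonneg fun j hj => (hc j (Finset.mem_range.1 hj)).le)) (hΛ ρ hρ)
    rw [integral_residualMin hlm (by omega) (by omega) (hapos ρ hρ) hc, hshift,
      lintegral_botSum_congr (hapos ρ hρ) hr hc (fun i hi => dif_neg (not_lt.2 hi))
        (f := fun s => ENNReal.ofReal s * ENNReal.ofReal (2 * s)) (by fun_prop)] at hle
    rw [Real.dist_eq]
    exact hle
  · refine tendsto_nhdsWithin_of_tendsto_nhds ?_
    have hcont : Continuous fun ρ : Fin l → ℝ =>
        N * (((∑ i, ρ i) * ∑ j ∈ Finset.range n, c j) * M) := by fun_prop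
    have h0 := hcont.tendsto 0
    simpa using h0
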